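/- arXiv:math-ph/0411015 — 9 statements merged into one kernel-verified Lean document; each statement's English description precedes it below -/
import Mathlib

section
/- There exists a universal constant C > 0 with the following property: for every continuously differentiable function m : ℝ → ℂ with m₀ := sup_{k ∈ ℝ} (|m(k)| + |k|·|m′(k)|) < ∞, and every Schwartz function f : ℝ → ℂ, the function Mf(y) := ∫_ℝ m(k) · 𝓕f(k) · e^{2πiky} dk satisfies sup_{y ∈ ℝ} |Mf(y)| ≤ C · m₀ · (‖f‖_{L²} · ‖f′‖_{L²})^{1/2}. -/
open MeasureTheory Real
/-- The Fourier transform `𝓕f(k) = ∫_ℝ e^{−2πiky} f(y) dy`. -/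
noncomputable def fourierT (f : ℝ → ℂ) (k : ℝ) : ℂ :=
  ∫ y : ℝ, Complex.exp ((-2) * π * k * y * Complex.I) * f y

open scoped FourierTransform

theorem l1_bound (g h : ℝ → ℂ) (hg : Integrable g) (hg2 : Integrable (fun k => ‖g k‖ ^ 2))
    (hh2 : Integrable (fun k => ‖h k‖ ^ 2)) (hgh : ∀ k, |k| * ‖g k‖ ≤ ‖h k‖)
    (a b : ℝ) (ha : 0 ≤ a) (hb : 0 ≤ b) (hA : ∫ k, ‖g k‖ ^ 2 = a ^ 2)
    (hB : ∫ k, ‖h k‖ ^ 2 = b ^ 2) :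
    ∫ k, ‖g k‖ ≤ (1 + π / 2) * Real.sqrt (a * b) := by
  rcases ha.eq_or_lt with rfl | ha
  · have h0 : (fun k => ‖g k‖ ^ 2) =ᵐ[volume] 0 :=
      (integral_eq_zero_iff_of_nonneg (fun k => by positivity) hg2).1 (by simpa using hA)
    have h1 : (fun k => ‖g k‖) =ᵐ[volume] 0 := by
      filter_upwards [h0] with k hk
      simpa using hk
    rw [integral_congr_ae h1]
    simp
  rcases hb.eq_or_lt with rfl | hb
  · have h0 : (fun k => ‖h k‖ ^ 2) =ᵐ[volume] 0 :=
      (integral_eq_zero_iff_of_nonneg (fun k => by positivity) hh2).1 (by simpa using hB)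
    have h1 : (fun k => ‖g k‖) =ᵐ[volume] 0 := by
      filter_upwards [h0, Measure.ae_ne volume (0 : ℝ)] with k hk hk0
      have h2 : ‖h k‖ = 0 := by simpa using hk
      have h3 := hgh k
      rw [h2] at h3
      have h4 : 0 < |k| := abs_pos.2 hk0
      have h5 : 0 ≤ ‖g k‖ := norm_nonneg _
      show ‖g k‖ = 0
      nlinarith
    rw [integral_congr_ae h1]
    simp
  set s := Real.sqrt (a * b) with hs
  have hs0 : 0 < s := Real.sqrt_pos.2 (by positivity)
  have hs2 : s ^ 2 = a * b := Real.sq_sqrt (by positivity)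
  set l := a / b with hl
  have hl0 : 0 < l := by positivity
  set e := s / a ^ 2 with he
  have he0 : 0 < e := by positivity
  have hI : Integrable (fun k : ℝ => (1 + (l * k) ^ 2)⁻¹) :=
    integrable_inv_one_add_sq.comp_mul_left' hl0.ne'
  have hIv : ∫ k : ℝ, (1 + (l * k) ^ 2)⁻¹ = l⁻¹ * π := by
    have := Measure.integral_comp_mul_left (fun x : ℝ => (1 + x ^ 2)⁻¹) l
    rw [this, integral_univ_inv_one_add_sq, abs_of_pos (by positivity), smul_eq_mul]
  have hsum : Integrable (fun k => ‖g k‖ ^ 2 + l ^ 2 * ‖h k‖ ^ 2) :=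
    hg2.add (hh2.const_mul _)
  have key : ∀ k, ‖g k‖ ≤ (e / 2) * (‖g k‖ ^ 2 + l ^ 2 * ‖h k‖ ^ 2)
      + (1 / (2 * e)) * (1 + (l * k) ^ 2)⁻¹ := by
    intro k
    have hw : 0 < 1 + (l * k) ^ 2 := by positivity
    set w := 1 + (l * k) ^ 2 with hwd
    have h1 : k ^ 2 * ‖g k‖ ^ 2 ≤ ‖h k‖ ^ 2 := by
      have := pow_le_pow_left₀ (by positivity) (hgh k) 2
      rwa [mul_pow, sq_abs] at this
    have h2 : ‖g k‖ ^ 2 * w ≤ ‖g k‖ ^ 2 + l ^ 2 * ‖h k‖ ^ 2 := by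
      have := mul_le_mul_of_nonneg_left h1 (sq_nonneg l)
      rw [hwd]; nlinarith
    have h3 : ‖g k‖ ≤ (e / 2) * (‖g k‖ ^ 2 * w) + (1 / (2 * e)) * w⁻¹ := by
      have h4 : (e / 2) * (‖g k‖ ^ 2 * w) + (1 / (2 * e)) * w⁻¹ - ‖g k‖
          = (e * w * ‖g k‖ - 1) ^ 2 / (2 * e * w) := by
        field_simp
        ring
      have : 0 ≤ (e * w * ‖g k‖ - 1) ^ 2 / (2 * e * w) := by positivity
      linarith
    have := mul_le_mul_of_nonneg_left h2 (by positivity : 0 ≤ e / 2)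
    linarith
  calc ∫ k, ‖g k‖ ≤ ∫ k, ((e / 2) * (‖g k‖ ^ 2 + l ^ 2 * ‖h k‖ ^ 2)
      + (1 / (2 * e)) * (1 + (l * k) ^ 2)⁻¹) :=
        integral_mono hg.norm ((hsum.const_mul _).add (hI.const_mul _)) key
    _ = (e / 2) * (a ^ 2 + l ^ 2 * b ^ 2) + (1 / (2 * e)) * (l⁻¹ * π) := by
        rw [integral_add (hsum.const_mul _) (hI.const_mul _), integral_const_mul,
          integral_const_mul, integral_add hg2 (hh2.const_mul _), integral_const_mul, hA, hB, hIv]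
    _ = (1 + π / 2) * s := by
        have e1 : (e / 2) * (a ^ 2 + l ^ 2 * b ^ 2) = s := by
          rw [he, hl]; field_simp; ring
        have e2 : (1 / (2 * e)) * (l⁻¹ * π) = π / 2 * s := by
          rw [he, hl]; field_simp; rw [hs2]
        rw [e1, e2]; ring

theorem schwartz_sq (g : SchwartzMap ℝ ℂ) : Integrable (fun k => ‖g k‖ ^ 2) := by
  have := (g.memLp 2 volume).integrable_norm_pow (by norm_num)
  simpa using this

theorem fourierT_eq (f : SchwartzMap ℝ ℂ) (k : ℝ) : fourierT (⇑f) k = (𝓕 f) k := by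
  rw [SchwartzMap.fourier_coe, Real.fourier_real_eq_integral_exp_smul]
  unfold fourierT
  congr 1
  ext v
  rw [smul_eq_mul]
  congr 2
  push_cast
  ring

theorem fourier_weight (f f' : SchwartzMap ℝ ℂ) (hf'c : (⇑f' : ℝ → ℂ) = deriv (⇑f)) (k : ℝ) :
    |k| * ‖(𝓕 f) k‖ ≤ ‖(𝓕 f') k‖ := by
  rw [SchwartzMap.fourier_coe, SchwartzMap.fourier_coe, hf'c,
    Real.fourier_deriv f.integrable f.differentiable (hf'c ▸ f'.integrable)]
  simp only [norm_smul, norm_mul, Complex.norm_I, Complex.norm_real, Complex.norm_ofNat,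
    Real.norm_eq_abs, abs_of_pos Real.pi_pos]
  have h1 : 0 ≤ |k| * ‖(𝓕 (⇑f : ℝ → ℂ)) k‖ := by positivity
  nlinarith [Real.pi_gt_three]

theorem fourier_l1 (f f' : SchwartzMap ℝ ℂ) (hf'c : (⇑f' : ℝ → ℂ) = deriv (⇑f)) :
    ∫ k, ‖(𝓕 f) k‖ ≤ (1 + π / 2) * Real.sqrt
                ((∫ t : ℝ, ‖f t‖ ^ 2) ^ ((1 : ℝ) / 2) *
                  (∫ t : ℝ, ‖deriv (⇑f) t‖ ^ 2) ^ ((1 : ℝ) / 2)) := by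
  have hA : ∫ k, ‖(𝓕 f) k‖ ^ 2 = ((∫ t : ℝ, ‖f t‖ ^ 2) ^ ((1 : ℝ) / 2)) ^ 2 := by
    rw [SchwartzMap.integral_norm_sq_fourier, ← Real.sqrt_eq_rpow, Real.sq_sqrt (by positivity)]
  have hB : ∫ k, ‖(𝓕 f') k‖ ^ 2 = ((∫ t : ℝ, ‖deriv (⇑f) t‖ ^ 2) ^ ((1 : ℝ) / 2)) ^ 2 := by
    rw [SchwartzMap.integral_norm_sq_fourier, ← Real.sqrt_eq_rpow, Real.sq_sqrt (by positivity),
      hf'c]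
  have hw := fourier_weight f f' hf'c
  generalize (𝓕 f : SchwartzMap ℝ ℂ) = g at *
  generalize (𝓕 f' : SchwartzMap ℝ ℂ) = h at *
  have hg : Integrable (fun k => g k) := g.integrable
  exact l1_bound (fun k => g k) (fun k => h k) hg (schwartz_sq g)
    (schwartz_sq h) hw _ _ (by positivity) (by positivity) hA hB

/-- Mikhlin–Hörmander, sup-norm estimate. There is a universal constant
`C > 0` such that for every `C¹` multiplier `m : ℝ → ℂ` with
`∀ k, |m(k)| + |k|·|m′(k)| ≤ m₀` and every Schwartz function `f`,
`sup_y |∫ m(k) 𝓕f(k) e^{2πiky} dk| ≤ C·m₀·(‖f‖_{L²}·‖f′‖_{L²})^{1/2}`. -/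
theorem stmt2 :
    ∃ C : ℝ, 0 < C ∧
      ∀ m : ℝ → ℂ, ContDiff ℝ 1 m →
        ∀ m₀ : ℝ, (∀ k : ℝ, ‖m k‖ + |k| * ‖deriv m k‖ ≤ m₀) →
          ∀ f : SchwartzMap ℝ ℂ, ∀ y : ℝ,
            ‖∫ k : ℝ, m k * fourierT (⇑f) k * Complex.exp (2 * π * k * y * Complex.I)‖ ≤
              C * m₀ * Real.sqrt
                ((∫ t : ℝ, ‖f t‖ ^ 2) ^ ((1 : ℝ) / 2) *
                  (∫ t : ℝ, ‖deriv (⇑f) t‖ ^ 2) ^ ((1 : ℝ) / 2)) := by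
  refine ⟨1 + π / 2, by positivity, ?_⟩
  intro m _ m₀ hm f y
  have hm0 : 0 ≤ m₀ := le_trans (by positivity) (hm 0)
  have hmk : ∀ k, ‖m k‖ ≤ m₀ := fun k =>
    le_trans (le_add_of_nonneg_right (by positivity)) (hm k)
  obtain ⟨f', hf'c⟩ : ∃ f' : SchwartzMap ℝ ℂ, (⇑f' : ℝ → ℂ) = deriv (⇑f) :=
    ⟨SchwartzMap.derivCLM ℂ ℂ f, funext fun x => SchwartzMap.derivCLM_apply ℂ f x⟩
  have hF := fourierT_eq f
  have hb := fourier_l1 f f' hf'c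
  calc _ ≤ ∫ k, m₀ * ‖(𝓕 f) k‖ := by
        refine norm_integral_le_of_norm_le ((𝓕 f).integrable.norm.const_mul _) ?_
        refine Filter.Eventually.of_forall fun k => ?_
        have : ‖Complex.exp (2 * π * k * y * Complex.I)‖ = 1 := by
          have := Complex.norm_exp_ofReal_mul_I (2 * π * k * y)
          push_cast at this
          exact this
        rw [norm_mul, norm_mul, this, mul_one, hF]
        exact mul_le_mul_of_nonneg_right (hmk k) (norm_nonneg _)
    _ = m₀ * ∫ k, ‖(𝓕 f) k‖ := integral_const_mul _ _
    _ ≤ _ := by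
        refine (mul_le_mul_of_nonneg_left hb hm0).trans_eq ?_
        ring
end

section
/- There exists a universal constant C > 0 with the following property: for every continuously differentiable function m : ℝ → ℂ with m₀ := sup_{k ∈ ℝ} (|m(k)| + |k|·|m′(k)|) < ∞ and m₁ := sup_{k ∈ ℝ} |m′(k)| < ∞, and every Schwartz function f : ℝ → ℂ, the function Mf(y) := ∫_ℝ m(k) · 𝓕f(k) · e^{2πiky} dk is integrable and satisfies ∫_ℝ |Mf(y)| dy ≤ C · ( m₀ · (‖f‖_{L²} · ‖y f‖_{L²})^{1/2} + (m₀ · m₁)^{1/2} · ‖f‖_{L²} ), where ‖y f‖_{L²} is the L² norm of y ↦ y·f(y). -/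
open MeasureTheory Real

open scoped FourierTransform SchwartzMap

lemma aux_plancherel (g : ℝ → ℂ) (h1 : Integrable g) (h2 : MemLp g 2) :
    MemLp (𝓕 g) 2 ∧ ∫ x, ‖𝓕 g x‖ ^ 2 = ∫ x, ‖g x‖ ^ 2 := by
  have hcont : Continuous (𝓕 g) :=
    VectorFourier.fourierIntegral_continuous Real.continuous_fourierChar
      (innerSL ℝ).continuous₂ h1
  set G : Lp ℂ 2 (volume : Measure ℝ) := h2.toLp g with hG
  have key : ∀ᵐ x, (𝓕 G : Lp ℂ 2 (volume : Measure ℝ)) x = 𝓕 g x := by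
    apply ae_eq_of_integral_contDiff_smul_eq
    · exact (Lp.memLp (𝓕 G)).locallyIntegrable (by norm_num)
    · exact hcont.locallyIntegrable
    · intro p p_smooth p_cpt
      have hg₁ : HasCompactSupport (Complex.ofRealCLM ∘ p) := p_cpt.comp_left rfl
      have hg₂ : ContDiff ℝ ((⊤ : ℕ∞) : WithTop ℕ∞) (Complex.ofRealCLM ∘ p) := by fun_prop
      set P : 𝓢(ℝ, ℂ) := hg₁.toSchwartzMap hg₂ with hP
      have e1 := DFunLike.congr_fun (Lp.fourier_toTemperedDistribution_eq G) P
      rw [TemperedDistribution.fourier_apply, Lp.toTemperedDistribution_apply,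
        Lp.toTemperedDistribution_apply] at e1
      have e2 : ∫ x, p x • (𝓕 G : Lp ℂ 2 (volume : Measure ℝ)) x
          = ∫ x, P x • (𝓕 G : Lp ℂ 2 (volume : Measure ℝ)) x := by
        simp [hP]
      have e3 : ∫ x, p x • 𝓕 g x = ∫ x, P x • 𝓕 g x := by
        simp [hP]
      rw [e2, e3, ← e1]
      have e4 : ∫ x, (𝓕 P) x • G x = ∫ x, (𝓕 P) x • g x := by
        apply integral_congr_ae
        filter_upwards [h2.coeFn_toLp] with x hx
        rw [hx]
      rw [e4, SchwartzMap.fourier_coe]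
      have e5 := VectorFourier.integral_fourierIntegral_smul_eq_flip (L := innerₗ ℝ)
        Real.continuous_fourierChar (innerSL ℝ).continuous₂ (P.integrable (μ := volume)) h1
      rw [flip_innerₗ] at e5
      exact e5
  have hm : MemLp (𝓕 g) 2 := (memLp_congr_ae key).1 (Lp.memLp _)
  refine ⟨hm, ?_⟩
  have n1 : ∀ u : ℝ → ℂ, ∀ hu : MemLp u 2, ∫ x, ‖u x‖ ^ 2 = ‖hu.toLp u‖ ^ 2 := by
    intro u hu
    rw [← inner_self_eq_norm_sq (𝕜 := ℂ), L2.inner_def, ← integral_re (L2.integrable_inner _ _)]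
    apply integral_congr_ae
    filter_upwards [hu.coeFn_toLp] with x hx
    rw [hx, inner_self_eq_norm_sq]
  rw [n1 _ hm, n1 _ h2]
  have : hm.toLp (𝓕 g) = 𝓕 G := by
    apply Lp.ext
    filter_upwards [hm.coeFn_toLp, key] with x h h'
    rw [h, h']
  rw [this, Lp.norm_fourier_eq]

lemma aux_pos (h : ℝ → ℂ) (hc : Continuous h) (i1 : Integrable fun y => ‖h y‖ ^ 2)
    (i2 : Integrable fun y : ℝ => ‖(y : ℂ) * h y‖ ^ 2) (A B : ℝ) (hA : 0 < A) (hB : 0 < B)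
    (a : ∫ y, ‖h y‖ ^ 2 ≤ A ^ 2) (b : ∫ y : ℝ, ‖(y : ℂ) * h y‖ ^ 2 ≤ B ^ 2) :
    Integrable h ∧ ∫ y, ‖h y‖ ≤ 3 * √(A * B) := by
  set s := √(A * B) with hs
  have hs0 : 0 < s := by positivity
  have hs2 : s ^ 2 = A * B := Real.sq_sqrt (by positivity)
  -- weights
  have i3 : Integrable fun y : ℝ => (1 + ((A / B) * y) ^ 2)⁻¹ :=
    integrable_inv_one_add_sq.comp_mul_left' (by positivity)
  have v3 : ∫ y : ℝ, (1 + ((A / B) * y) ^ 2)⁻¹ = (B / A) * π := by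
    rw [Measure.integral_comp_mul_left (fun y : ℝ => (1 + y ^ 2)⁻¹), integral_univ_inv_one_add_sq]
    rw [abs_of_pos (by positivity), smul_eq_mul]; simp
  have pt : ∀ y : ℝ, ‖h y‖ ≤ (s / (2 * A ^ 2)) * ‖h y‖ ^ 2
      + (s / (2 * B ^ 2)) * ‖(y : ℂ) * h y‖ ^ 2
      + (A ^ 2 / (2 * s)) * (1 + ((A / B) * y) ^ 2)⁻¹ := by
    intro y
    rw [norm_mul, Complex.norm_real, mul_pow, Real.norm_eq_abs, sq_abs]
    set n := ‖h y‖
    set w := 1 + ((A / B) * y) ^ 2 with hw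
    have hw0 : 0 < w := by positivity
    have : (s / (2 * A ^ 2)) * n ^ 2 + (s / (2 * B ^ 2)) * (y ^ 2 * n ^ 2)
      + (A ^ 2 / (2 * s)) * w⁻¹ - n = (s * w * n - A ^ 2) ^ 2 / (2 * A ^ 2 * s * w) := by
      have : (s / (2 * A ^ 2)) * n ^ 2 + (s / (2 * B ^ 2)) * (y ^ 2 * n ^ 2)
        = s / (2 * A ^ 2) * w * n ^ 2 := by rw [hw]; field_simp
      rw [this]; field_simp; ring
    have h0 : 0 ≤ (s * w * n - A ^ 2) ^ 2 / (2 * A ^ 2 * s * w) := by positivity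
    linarith
  have j : Integrable fun y : ℝ => (s / (2 * A ^ 2)) * ‖h y‖ ^ 2
      + (s / (2 * B ^ 2)) * ‖(y : ℂ) * h y‖ ^ 2
      + (A ^ 2 / (2 * s)) * (1 + ((A / B) * y) ^ 2)⁻¹ :=
    ((i1.const_mul _).add (i2.const_mul _)).add (i3.const_mul _)
  have ih : Integrable h := j.mono' hc.aestronglyMeasurable (.of_forall pt)
  refine ⟨ih, (integral_mono ih.norm j pt).trans ?_⟩
  have i12 : Integrable fun y : ℝ => (s / (2 * A ^ 2)) * ‖h y‖ ^ 2
      + (s / (2 * B ^ 2)) * ‖(y : ℂ) * h y‖ ^ 2 := (i1.const_mul _).add (i2.const_mul _)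
  rw [integral_add i12 (i3.const_mul _),
    integral_add (i1.const_mul _) (i2.const_mul _), integral_const_mul, integral_const_mul,
    integral_const_mul, v3]
  have t1 : (s / (2 * A ^ 2)) * (∫ y, ‖h y‖ ^ 2) ≤ s / 2 := by
    calc _ ≤ (s / (2 * A ^ 2)) * A ^ 2 := by gcongr
      _ = s / 2 := by field_simp
  have t2 : (s / (2 * B ^ 2)) * (∫ y : ℝ, ‖(y : ℂ) * h y‖ ^ 2) ≤ s / 2 := by
    calc _ ≤ (s / (2 * B ^ 2)) * B ^ 2 := by gcongr
      _ = s / 2 := by field_simp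
  have t3 : (A ^ 2 / (2 * s)) * (B / A * π) = s * π / 2 := by
    field_simp; rw [hs2]
  have := Real.pi_lt_four
  rw [t3]
  nlinarith

lemma aux_L1 (h : ℝ → ℂ) (hc : Continuous h) (i1 : Integrable fun y => ‖h y‖ ^ 2)
    (i2 : Integrable fun y : ℝ => ‖(y : ℂ) * h y‖ ^ 2) (A B : ℝ) (hA : 0 ≤ A) (hB : 0 ≤ B)
    (a : ∫ y, ‖h y‖ ^ 2 ≤ A ^ 2) (b : ∫ y : ℝ, ‖(y : ℂ) * h y‖ ^ 2 ≤ B ^ 2) :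
    Integrable h ∧ ∫ y, ‖h y‖ ≤ 3 * √(A * B) := by
  have H : ∀ e : ℝ, 0 < e → Integrable h ∧ ∫ y, ‖h y‖ ≤ 3 * √((A + e) * (B + e)) := by
    intro e he
    apply aux_pos h hc i1 i2 _ _ (by positivity) (by positivity)
    · exact a.trans (by gcongr; linarith)
    · exact b.trans (by gcongr; linarith)
  refine ⟨(H 1 one_pos).1, ?_⟩
  have : Filter.Tendsto (fun e : ℝ => 3 * √((A + e) * (B + e))) (nhdsWithin 0 (Set.Ioi 0))
      (nhds (3 * √((A + 0) * (B + 0)))) := by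
    apply Filter.Tendsto.mono_left _ nhdsWithin_le_nhds
    exact Continuous.tendsto (f := fun e : ℝ => 3 * √((A + e) * (B + e))) (by fun_prop) 0
  simp only [add_zero] at this
  refine ge_of_tendsto this ?_
  filter_upwards [self_mem_nhdsWithin] with e he using (H e he).2

lemma aux_final (m₀ m₁ F Y : ℝ) (h0 : 0 ≤ m₀) (h1 : 0 ≤ m₁) (hF : 0 ≤ F) (hY : 0 ≤ Y) :
    3 * √((m₀ * F) * (2 * (m₁ * F + m₀ * Y))) ≤ 6 * (m₀ * √(F * Y) + √(m₀ * m₁) * F) := by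
  have : √((m₀ * F) * (2 * (m₁ * F + m₀ * Y))) ≤ 2 * (m₀ * √(F * Y) + √(m₀ * m₁) * F) := by
    apply Real.sqrt_le_iff.2 ⟨by positivity, ?_⟩
    have e1 := Real.sq_sqrt (mul_nonneg hF hY)
    have e2 := Real.sq_sqrt (mul_nonneg h0 h1)
    have : 0 ≤ m₀ * √(F * Y) * (√(m₀ * m₁) * F) := by positivity
    have : 0 ≤ m₀ ^ 2 * (F * Y) := by positivity
    have : 0 ≤ m₀ * m₁ * F ^ 2 := by positivity
    have : (2 * (m₀ * √(F * Y) + √(m₀ * m₁) * F)) ^ 2 = 4 * (m₀ ^ 2 * (F * Y))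
      + 4 * (m₀ * m₁ * F ^ 2) + 8 * (m₀ * √(F * Y) * (√(m₀ * m₁) * F)) := by
      rw [← e1, ← e2, e1, e2]
      have : (2 * (m₀ * √(F * Y) + √(m₀ * m₁) * F)) ^ 2 = 4 * (m₀ ^ 2 * √(F * Y) ^ 2)
        + 4 * (√(m₀ * m₁) ^ 2 * F ^ 2) + 8 * (m₀ * √(F * Y) * (√(m₀ * m₁) * F)) := by ring
      rw [this, e1, e2]
    nlinarith
  linarith

lemma aux_main (m : ℝ → ℂ) (hm : ContDiff ℝ 1 m) (m₀ m₁ : ℝ)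
    (hm0 : ∀ k : ℝ, ‖m k‖ ≤ m₀) (hm1 : ∀ k : ℝ, ‖deriv m k‖ ≤ m₁) (f : 𝓢(ℝ, ℂ)) :
    Integrable (𝓕 (fun k => m k * 𝓕 (f : ℝ → ℂ) k)) ∧
    ∫ y, ‖𝓕 (fun k => m k * 𝓕 (f : ℝ → ℂ) k) y‖ ≤
      6 * (m₀ * √(√(∫ t : ℝ, ‖f t‖ ^ 2) * √(∫ t : ℝ, ‖(t : ℂ) * f t‖ ^ 2)) +
        √(m₀ * m₁) * √(∫ t : ℝ, ‖f t‖ ^ 2)) := by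
  have p0 : 0 ≤ m₀ := (norm_nonneg _).trans (hm0 0)
  have p1 : 0 ≤ m₁ := (norm_nonneg _).trans (hm1 0)
  set F := √(∫ t : ℝ, ‖f t‖ ^ 2) with hF
  set Y := √(∫ t : ℝ, ‖(t : ℂ) * f t‖ ^ 2) with hY
  have hF2 : F ^ 2 = ∫ t : ℝ, ‖f t‖ ^ 2 := Real.sq_sqrt (integral_nonneg fun _ => by positivity)
  have hY2 : Y ^ 2 = ∫ t : ℝ, ‖(t : ℂ) * f t‖ ^ 2 :=
    Real.sq_sqrt (integral_nonneg fun _ => by positivity)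
  set φ : 𝓢(ℝ, ℂ) := 𝓕 f with hφ
  have hφc : 𝓕 (f : ℝ → ℂ) = φ := (SchwartzMap.fourier_coe f).symm
  rw [hφc]
  have htg : (fun x : ℝ => (-2 * π * Complex.I * x : ℂ)).HasTemperateGrowth := by fun_prop
  set ψ : 𝓢(ℝ, ℂ) := SchwartzMap.smulLeftCLM ℂ (fun x : ℝ => (-2 * π * Complex.I * x : ℂ)) f
    with hψ
  have hψc : (ψ : ℝ → ℂ) = fun x : ℝ => (-2 * π * Complex.I * x : ℂ) • f x := by
    ext x; rw [hψ, SchwartzMap.smulLeftCLM_apply_apply htg]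
  have hxf : Integrable fun x : ℝ => x • f x := by
    have := ψ.integrable.const_mul (-2 * π * Complex.I : ℂ)⁻¹ (μ := volume)
    refine this.congr (.of_forall fun x => ?_)
    have := Complex.I_ne_zero
    have : (π : ℂ) ≠ 0 := by exact_mod_cast Real.pi_ne_zero
    simp only [hψc, smul_eq_mul, Complex.real_smul]
    field_simp
  set χ : 𝓢(ℝ, ℂ) := 𝓕 ψ with hχ
  have hχc : 𝓕 (ψ : ℝ → ℂ) = χ := (SchwartzMap.fourier_coe ψ).symm
  have hd : ∀ k, HasDerivAt φ (χ k) k := by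
    intro k
    have := Real.hasDerivAt_fourier f.integrable hxf k
    rw [← hψc, hχc, hφc] at this
    exact this
  have hmd : ∀ k, HasDerivAt m (deriv m k) k := fun k =>
    (hm.differentiable (by norm_num) k).hasDerivAt
  have hm'c : Continuous (deriv m) := hm.continuous_deriv (by norm_num)
  set g : ℝ → ℂ := fun k => m k * φ k with hg
  have hgd : ∀ k, HasDerivAt g (deriv m k * φ k + m k * χ k) k := fun k => (hmd k).mul (hd k)
  have hg' : deriv g = fun k => deriv m k * φ k + m k * χ k := funext fun k => (hgd k).deriv
  -- integrability
  have φ2 : MemLp φ 2 := φ.memLp 2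
  have χ2 : MemLp χ 2 := χ.memLp 2
  have gb : ∀ k, ‖g k‖ ≤ m₀ * ‖φ k‖ := fun k => by
    rw [hg, norm_mul]; exact mul_le_mul_of_nonneg_right (hm0 k) (norm_nonneg _)
  have gi : Integrable g := φ.integrable.bdd_mul hm.continuous.aestronglyMeasurable
    (.of_forall hm0)
  have bddL2 : ∀ (u : ℝ → ℂ) (c : ℝ) (v : 𝓢(ℝ, ℂ)), Continuous u → (∀ k, ‖u k‖ ≤ c) →
      MemLp (fun k => u k * v k) 2 := by
    intro u c v hu hc
    refine (v.memLp 2 volume).of_le_mul (c := c) (hu.mul v.continuous).aestronglyMeasurable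
      (.of_forall fun k => ?_)
    rw [norm_mul]; exact mul_le_mul_of_nonneg_right (hc k) (norm_nonneg _)
  have g2 : MemLp g 2 := bddL2 m m₀ φ hm.continuous hm0
  have g'i : Integrable (deriv g) := by
    rw [hg']
    exact (φ.integrable.bdd_mul hm'c.aestronglyMeasurable (.of_forall hm1)).add
      (χ.integrable.bdd_mul hm.continuous.aestronglyMeasurable (.of_forall hm0))
  have g'2 : MemLp (deriv g) 2 := by
    rw [hg']
    exact (bddL2 _ m₁ φ hm'c hm1).add (bddL2 _ m₀ χ hm.continuous hm0)
  obtain ⟨q1, q2⟩ := aux_plancherel g gi g2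
  obtain ⟨r1, r2⟩ := aux_plancherel (deriv g) g'i g'2
  have hfd := Real.fourier_deriv gi (fun k => (hgd k).differentiableAt) g'i
  have sqi : ∀ u : ℝ → ℂ, MemLp u 2 → Integrable fun x => ‖u x‖ ^ 2 := fun u hu => hu.norm.integrable_sq
  have nrm : ∀ y : ℝ, ‖(y : ℂ) * 𝓕 g y‖ ^ 2 = (2 * π)⁻¹ ^ 2 * ‖𝓕 (deriv g) y‖ ^ 2 := by
    intro y
    rw [hfd]
    simp only [smul_eq_mul, norm_mul, Complex.norm_real, Complex.norm_I, Real.norm_eq_abs,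
      abs_of_pos Real.pi_pos, Complex.norm_ofNat]
    have := Real.pi_ne_zero
    field_simp
  -- Plancherel for f and ψ
  have plφ : ∫ k, ‖φ k‖ ^ 2 = F ^ 2 := by
    rw [hF2]; exact SchwartzMap.integral_norm_sq_fourier f
  have plχ : ∫ k, ‖χ k‖ ^ 2 = (2 * π) ^ 2 * Y ^ 2 := by
    rw [hY2, ← integral_const_mul]
    refine (SchwartzMap.integral_norm_sq_fourier ψ).trans ?_
    congr 1; ext x
    rw [hψc]
    simp only [smul_eq_mul, norm_mul, Complex.norm_real, Complex.norm_I, Real.norm_eq_abs,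
      abs_of_pos Real.pi_pos, Complex.norm_ofNat, norm_neg]
    ring
  have hcont : Continuous (𝓕 g) :=
    VectorFourier.fourierIntegral_continuous Real.continuous_fourierChar
      (innerSL ℝ).continuous₂ gi
  have F0 : 0 ≤ F := Real.sqrt_nonneg _
  have Y0 : 0 ≤ Y := Real.sqrt_nonneg _
  have res := aux_L1 (𝓕 g) hcont (sqi _ q1)
    (by simp_rw [nrm]; exact (sqi _ r1).const_mul _) (m₀ * F) (2 * (m₁ * F + m₀ * Y))
    (by positivity) (by positivity) ?_ ?_
  · exact ⟨res.1, res.2.trans (aux_final m₀ m₁ F Y p0 p1 F0 Y0)⟩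
  · rw [q2, mul_pow, ← plφ, ← integral_const_mul]
    refine integral_mono (sqi _ g2) ((sqi _ φ2).const_mul _) fun k => ?_
    simp only
    rw [← mul_pow]
    exact pow_le_pow_left₀ (norm_nonneg _) (gb k) 2
  · simp_rw [nrm]
    rw [integral_const_mul, r2]
    have e : ∫ k, ‖deriv g k‖ ^ 2 ≤ 2 * m₁ ^ 2 * F ^ 2 + 2 * m₀ ^ 2 * ((2 * π) ^ 2 * Y ^ 2) := by
      rw [← plφ, ← plχ, ← integral_const_mul, ← integral_const_mul,
        ← integral_add ((sqi _ φ2).const_mul _) ((sqi _ χ2).const_mul _)]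
      refine integral_mono (sqi _ g'2) (((sqi _ φ2).const_mul _).add ((sqi _ χ2).const_mul _))
        fun k => ?_
      simp only [hg']
      have b1 : ‖deriv m k * φ k‖ ≤ m₁ * ‖φ k‖ := by
        rw [norm_mul]; exact mul_le_mul_of_nonneg_right (hm1 k) (norm_nonneg _)
      have b2 : ‖m k * χ k‖ ≤ m₀ * ‖χ k‖ := by
        rw [norm_mul]; exact mul_le_mul_of_nonneg_right (hm0 k) (norm_nonneg _)
      have b3 := (norm_add_le (deriv m k * φ k) (m k * χ k)).trans (add_le_add b1 b2)
      have b4 := pow_le_pow_left₀ (norm_nonneg _) b3 2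
      nlinarith [sq_nonneg (m₁ * ‖φ k‖ - m₀ * ‖χ k‖)]
    have hpi : (2 * π)⁻¹ ^ 2 ≤ 1 := by
      apply pow_le_one₀ (by positivity)
      apply inv_le_one_of_one_le₀
      linarith [Real.pi_gt_three]
    calc (2 * π)⁻¹ ^ 2 * ∫ k, ‖deriv g k‖ ^ 2
        ≤ (2 * π)⁻¹ ^ 2 * (2 * m₁ ^ 2 * F ^ 2 + 2 * m₀ ^ 2 * ((2 * π) ^ 2 * Y ^ 2)) := by gcongr
      _ = (2 * π)⁻¹ ^ 2 * (2 * m₁ ^ 2 * F ^ 2) + 2 * m₀ ^ 2 * Y ^ 2 := by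
        have := Real.pi_ne_zero
        field_simp
      _ ≤ 1 * (2 * m₁ ^ 2 * F ^ 2) + 2 * m₀ ^ 2 * Y ^ 2 := by gcongr
      _ ≤ _ := by
        have : 0 ≤ m₁ * F * (m₀ * Y) := by positivity
        nlinarith [sq_nonneg (m₁ * F), sq_nonneg (m₀ * Y)]

/-- Mikhlin–Hörmander, L¹ estimate. There is a universal constant `C > 0`
such that for every `C¹` multiplier `m` with `∀ k, |m(k)| + |k||m′(k)| ≤ m₀` and
`∀ k, |m′(k)| ≤ m₁`, and every Schwartz function `f`, the function
`Mf(y) = ∫ m(k) 𝓕f(k) e^{2πiky} dk` is integrable and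
`∫ |Mf| ≤ C (m₀ (‖f‖_{L²} ‖y f‖_{L²})^{1/2} + (m₀ m₁)^{1/2} ‖f‖_{L²})`. -/
theorem stmt3 :
    ∃ C : ℝ, 0 < C ∧
      ∀ m : ℝ → ℂ, ContDiff ℝ 1 m →
        ∀ m₀ m₁ : ℝ, (∀ k : ℝ, ‖m k‖ + |k| * ‖deriv m k‖ ≤ m₀) →
          (∀ k : ℝ, ‖deriv m k‖ ≤ m₁) →
          ∀ f : SchwartzMap ℝ ℂ,
            Integrable
              (fun y : ℝ =>
                ∫ k : ℝ, m k * fourierT (⇑f) k * Complex.exp (2 * π * k * y * Complex.I))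
              (volume : Measure ℝ) ∧
            (∫ y : ℝ,
                ‖∫ k : ℝ, m k * fourierT (⇑f) k * Complex.exp (2 * π * k * y * Complex.I)‖) ≤
              C * (m₀ * Real.sqrt
                    ((∫ t : ℝ, ‖f t‖ ^ 2) ^ ((1 : ℝ) / 2) *
                      (∫ t : ℝ, ‖(t : ℂ) * f t‖ ^ 2) ^ ((1 : ℝ) / 2)) +
                  Real.sqrt (m₀ * m₁) * (∫ t : ℝ, ‖f t‖ ^ 2) ^ ((1 : ℝ) / 2)) := by
  refine ⟨6, by norm_num, fun m hm m₀ m₁ h0 h1 f => ?_⟩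
  have h0' : ∀ k, ‖m k‖ ≤ m₀ := fun k =>
    (le_add_of_nonneg_right (by positivity)).trans (h0 k)
  obtain ⟨a, b⟩ := aux_main m hm m₀ m₁ h0' h1 f
  have hT : fourierT (⇑f) = 𝓕 (f : ℝ → ℂ) := by
    ext k
    rw [fourierT, Real.fourier_real_eq_integral_exp_smul]
    congr 1; ext y
    rw [smul_eq_mul]; congr 2; push_cast; ring
  have hM : (fun y : ℝ =>
      ∫ k : ℝ, m k * fourierT (⇑f) k * Complex.exp (2 * π * k * y * Complex.I)) =
      fun y => 𝓕 (fun k => m k * 𝓕 (f : ℝ → ℂ) k) (-y) := by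
    ext y
    rw [hT, Real.fourier_real_eq_integral_exp_smul]
    congr 1; ext k
    rw [smul_eq_mul, mul_comm]; congr 2; push_cast; ring
  refine ⟨by rw [hM]; exact a.comp_neg, ?_⟩
  have hM' : (fun y : ℝ =>
      ‖∫ k : ℝ, m k * fourierT (⇑f) k * Complex.exp (2 * π * k * y * Complex.I)‖) =
      fun y => ‖𝓕 (fun k => m k * 𝓕 (f : ℝ → ℂ) k) (-y)‖ :=
    funext fun y => congrArg norm (congrFun hM y)
  rw [hM']
  rw [integral_neg_eq_self (fun y => ‖𝓕 (fun k => m k * 𝓕 (f : ℝ → ℂ) k) y‖)]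
  simpa only [Real.sqrt_eq_rpow] using b
end

section
/- For every φ ≥ 0 there exists a constant C_φ > 0 such that for all x > 0 and all α ∈ ℝ, ∫_ℝ |k|^φ · e^{2·Re Λ₋(k,α)·x} dk ≤ C_φ · e^{b(α)·x} · ⟨x⟩^{(φ+1)/2} / x^{φ+1}. -/
open MeasureTheory

/-- `⟨x⟩ = √(1+x²)`. -/
noncomputable def jap (x : ℝ) : ℝ := Real.sqrt (1 + x ^ 2)

/-- `Λ₀(k,α)`: the principal complex square root of `1 + 4k² + 4iα`. -/
noncomputable def Lam0 (k α : ℝ) : ℂ :=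
  (1 + 4 * (k : ℂ) ^ 2 + 4 * (α : ℂ) * Complex.I) ^ ((1 : ℂ) / 2)

/-- `Λ₋(k,α) = (1 − Λ₀(k,α))/2`. -/
noncomputable def LamM (k α : ℝ) : ℂ := (1 - Lam0 k α) / 2

/-- `b(α) = (1/4)(1 − √((1+√(1+16α²))/2))`. -/
noncomputable def bCoef (α : ℝ) : ℝ :=
  (1 / 4) * (1 - Real.sqrt ((1 + Real.sqrt (1 + 16 * α ^ 2)) / 2))

lemma aux_re_nonneg (z : ℂ) : 0 ≤ (z ^ ((1 : ℂ) / 2)).re := by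
  by_cases hz : z = 0
  · subst hz; simp
  · rw [Complex.cpow_def_of_ne_zero hz, Complex.exp_re]
    have h1 : (Complex.log z * (1 / 2)).im = Complex.arg z / 2 := by
      have : (1 / 2 : ℂ) = ((1 / 2 : ℝ) : ℂ) := by push_cast; ring
      rw [this, Complex.im_mul_ofReal, Complex.log_im]; ring
    rw [h1]
    apply mul_nonneg (Real.exp_pos _).le
    apply Real.cos_nonneg_of_neg_pi_div_two_le_of_le
    · linarith [Complex.neg_pi_lt_arg z]
    · linarith [Complex.arg_le_pi z]

lemma aux_R (k α : ℝ) : Real.sqrt (1 + 4 * k ^ 2) ≤ (Lam0 k α).re ∧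
    Real.sqrt ((1 + Real.sqrt (1 + 16 * α ^ 2)) / 2) ≤ (Lam0 k α).re := by
  have h0 : 0 ≤ (Lam0 k α).re := aux_re_nonneg _
  have hsq : (Lam0 k α) ^ 2 = 1 + 4 * (k : ℂ) ^ 2 + 4 * (α : ℂ) * Complex.I := by
    have := Complex.cpow_nat_inv_pow (1 + 4 * (k : ℂ) ^ 2 + 4 * (α : ℂ) * Complex.I) (n := 2)
      (by norm_num)
    rw [← this, Lam0]; norm_num
  generalize Lam0 k α = w at *
  have hre := congrArg Complex.re hsq
  have him := congrArg Complex.im hsq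
  simp [pow_two] at hre him
  have hs : 0 ≤ w.im ^ 2 := sq_nonneg _
  have hk : 0 ≤ k ^ 2 := sq_nonneg _
  have hu : 1 + 4 * k ^ 2 ≤ w.re ^ 2 := by nlinarith
  refine ⟨Real.sqrt_le_iff.2 ⟨h0, hu⟩, Real.sqrt_le_iff.2 ⟨h0, ?_⟩⟩
  have h2 : w.re * w.im = 2 * α := by linarith
  have h3 : w.re ^ 2 * w.im ^ 2 = 4 * α ^ 2 := by rw [← mul_pow, h2]; ring
  have h4 : Real.sqrt (1 + 16 * α ^ 2) ≤ 2 * w.re ^ 2 - 1 := by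
    apply Real.sqrt_le_iff.2 ⟨by linarith, ?_⟩
    have h5 : w.im ^ 2 ≤ w.re ^ 2 - 1 := by nlinarith
    nlinarith [mul_le_mul_of_nonneg_left h5 (sq_nonneg w.re)]
  linarith

lemma aux_s (k : ℝ) : min (k ^ 2) |k| ≤ Real.sqrt (1 + 4 * k ^ 2) - 1 := by
  have ha := abs_nonneg k
  rw [← sq_abs k]
  generalize |k| = t at *
  rw [le_sub_iff_add_le]
  apply Real.le_sqrt_of_sq_le
  rcases le_total t 1 with h | h
  · rw [min_eq_left (by nlinarith)]
    nlinarith [mul_nonneg ha ha, mul_le_mul_of_nonneg_left h ha, mul_nonneg (mul_nonneg ha ha) (sub_nonneg.2 h), mul_nonneg (mul_nonneg (mul_nonneg ha ha) ha) (sub_nonneg.2 h)]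
  · rw [min_eq_right (by nlinarith)]
    nlinarith

lemma aux_pt (k α x : ℝ) (hx : 0 < x) : Real.exp (2 * (LamM k α).re * x) ≤
    Real.exp (bCoef α * x) * (Real.exp (-(3 / 4 * x) * |k| ^ (2 : ℝ)) +
      Real.exp (-(3 / 4 * x) * |k| ^ (1 : ℝ))) := by
  obtain ⟨h1, h2⟩ := aux_R k α
  have h3 := aux_s k
  have h4 : 2 * (LamM k α).re = 1 - (Lam0 k α).re := by
    have : (LamM k α) = ((1 / 2 : ℝ) : ℂ) * (1 - Lam0 k α) := by
      rw [LamM]; push_cast; ring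
    rw [this, Complex.re_ofReal_mul]; simp
  have h5 : 2 * (LamM k α).re * x ≤ bCoef α * x + -(3 / 4 * x) * min (k ^ 2) |k| := by
    have : 2 * (LamM k α).re ≤ bCoef α - 3 / 4 * min (k ^ 2) |k| := by
      rw [h4, bCoef]; linarith
    nlinarith
  refine (Real.exp_le_exp.2 h5).trans ?_
  rw [Real.exp_add]
  refine mul_le_mul_of_nonneg_left ?_ (Real.exp_pos _).le
  rw [Real.rpow_two, Real.rpow_one, sq_abs]
  rcases min_choice (k ^ 2) |k| with h | h <;> rw [h]
  · linarith [Real.exp_pos (-(3 / 4 * x) * |k|)]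
  · linarith [Real.exp_pos (-(3 / 4 * x) * k ^ 2)]

lemma aux_int (φ : ℝ) (hφ : 0 ≤ φ) (p c : ℝ) (hp : 1 ≤ p) (hc : 0 < c) :
    Integrable (fun k : ℝ => |k| ^ φ * Real.exp (-c * |k| ^ p)) ∧
    ∫ k : ℝ, |k| ^ φ * Real.exp (-c * |k| ^ p) =
      2 * (c ^ (-(φ + 1) / p) * (1 / p) * Real.Gamma ((φ + 1) / p)) := by
  have h : ∫ k : ℝ, |k| ^ φ * Real.exp (-c * |k| ^ p) =
      2 * (c ^ (-(φ + 1) / p) * (1 / p) * Real.Gamma ((φ + 1) / p)) := by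
    rw [integral_comp_abs (f := fun k => k ^ φ * Real.exp (-c * k ^ p)),
      integral_rpow_mul_exp_neg_mul_rpow (by linarith) (by linarith) hc]
  refine ⟨?_, h⟩
  by_contra hn
  rw [integral_undef hn] at h
  have hp0 : 0 < p := by linarith
  have := Real.Gamma_pos_of_pos (s := (φ + 1) / p) (by positivity)
  have h2 : 0 < 2 * (c ^ (-(φ + 1) / p) * (1 / p) * Real.Gamma ((φ + 1) / p)) := by positivity
  linarith

/-- For every `φ ≥ 0` there is `C_φ > 0` such that for all `x > 0`, `α ∈ ℝ`:
`∫_ℝ |k|^φ e^{2 Re Λ₋(k,α) x} dk ≤ C_φ e^{b(α)x} ⟨x⟩^{(φ+1)/2} / x^{φ+1}`. -/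
theorem stmt5 (φ : ℝ) (hφ : 0 ≤ φ) :
    ∃ C : ℝ, 0 < C ∧ ∀ x : ℝ, 0 < x → ∀ α : ℝ,
      (∫ k : ℝ, |k| ^ φ * Real.exp (2 * (LamM k α).re * x)) ≤
        C * Real.exp (bCoef α * x) * jap x ^ ((φ + 1) / 2) / x ^ (φ + 1) := by
  set A : ℝ := 2 * ((3 / 4 : ℝ) ^ (-(φ + 1) / 2) * (1 / 2) * Real.Gamma ((φ + 1) / 2)) with hA
  set B : ℝ := 2 * ((3 / 4 : ℝ) ^ (-(φ + 1) / 1) * (1 / 1) * Real.Gamma ((φ + 1) / 1)) with hB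
  have hA0 : 0 < A := by
    have := Real.Gamma_pos_of_pos (s := (φ + 1) / 2) (by positivity)
    positivity
  have hB0 : 0 < B := by
    have := Real.Gamma_pos_of_pos (s := (φ + 1) / 1) (by positivity)
    positivity
  refine ⟨A + B, by positivity, fun x hx α => ?_⟩
  obtain ⟨i1, e1⟩ := aux_int φ hφ 2 (3 / 4 * x) (by norm_num) (by positivity)
  obtain ⟨i2, e2⟩ := aux_int φ hφ 1 (3 / 4 * x) (by norm_num) (by positivity)
  have hx0 := hx.le
  have hxp : 0 < x ^ (φ + 1) := Real.rpow_pos_of_pos hx _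
  have f1 : x ^ (-(φ + 1) / 2) = x ^ ((φ + 1) / 2) / x ^ (φ + 1) := by
    rw [← Real.rpow_sub hx]; congr 1; ring
  have f2 : x ^ (-(φ + 1) / 1) = 1 / x ^ (φ + 1) := by
    rw [div_one, Real.rpow_neg hx0, one_div]
  have j1 : 1 ≤ jap x := by
    rw [jap]; exact Real.one_le_sqrt.2 (by nlinarith)
  have j2 : x ≤ jap x := Real.le_sqrt_of_sq_le (by linarith)
  have g1 : x ^ ((φ + 1) / 2) ≤ jap x ^ ((φ + 1) / 2) :=
    Real.rpow_le_rpow hx0 j2 (by positivity)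
  have g2 : 1 ≤ jap x ^ ((φ + 1) / 2) := Real.one_le_rpow j1 (by positivity)
  calc (∫ k : ℝ, |k| ^ φ * Real.exp (2 * (LamM k α).re * x))
      ≤ ∫ k : ℝ, Real.exp (bCoef α * x) * (|k| ^ φ * Real.exp (-(3 / 4 * x) * |k| ^ (2 : ℝ)) +
          |k| ^ φ * Real.exp (-(3 / 4 * x) * |k| ^ (1 : ℝ))) := by
        apply integral_mono_of_nonneg
        · exact Filter.Eventually.of_forall fun k => by positivity
        · exact (i1.add i2).const_mul _
        · refine Filter.Eventually.of_forall fun k => ?_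
          have h := mul_le_mul_of_nonneg_left (aux_pt k α x hx)
            (Real.rpow_nonneg (abs_nonneg k) φ)
          refine h.trans (le_of_eq ?_)
          ring
    _ = Real.exp (bCoef α * x) * ((A * x ^ ((φ + 1) / 2) + B * 1) / x ^ (φ + 1)) := by
        rw [integral_const_mul, integral_add i1 i2, e1, e2,
          Real.mul_rpow (by norm_num) hx0, Real.mul_rpow (by norm_num) hx0, f1, f2, hA, hB]
        ring
    _ ≤ Real.exp (bCoef α * x) * ((A * jap x ^ ((φ + 1) / 2) + B * jap x ^ ((φ + 1) / 2))
          / x ^ (φ + 1)) := by gcongr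
    _ = _ := by ring
end

section
/- Let p₁ < 1, s ≥ 0, and p₂, q₁, q₂ ∈ ℝ with q₂ ≠ 1. There exists a constant C > 0, depending only on these exponents, such that for all x ≥ x₀ ≥ 1, ∫_{x₀}^{x} min( ⟨t⟩^{−q₁}·(x−t)^{−p₁} , ⟨x⟩^{s}·⟨t⟩^{−q₂}·(x−t)^{−p₂} ) dt ≤ C·( ⟨x⟩^{1−q₁−p₁} + ⟨x⟩^{s−p₂}·max(⟨x⟩^{1−q₂}, ⟨x₀⟩^{1−q₂}) ). -/
open MeasureTheory

lemma rpow_cmp (a b r : ℝ) (hb : 0 < b) (h1 : b ≤ 4 * a) (h2 : a ≤ 4 * b) :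
    a ^ r ≤ 4 ^ |r| * b ^ r := by
  have ha : 0 < a := by linarith
  rcases le_total 0 r with hr | hr
  · rw [abs_of_nonneg hr, ← Real.mul_rpow (by norm_num) hb.le]
    exact Real.rpow_le_rpow ha.le h2 hr
  · have h : (4 * a) ^ r ≤ b ^ r := Real.rpow_le_rpow_of_nonpos hb h1 hr
    rw [Real.mul_rpow (by norm_num) ha.le] at h
    rw [abs_of_nonpos hr, Real.rpow_neg (by norm_num)]
    have h4 : (0:ℝ) < 4 ^ r := by positivity
    rw [inv_mul_eq_div, le_div_iff₀ h4]
    linarith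

lemma jap_ge (x : ℝ) : x ≤ jap x := by
  unfold jap
  exact Real.le_sqrt_of_sq_le (by linarith)

lemma jap_le (x : ℝ) (hx : 1 ≤ x) : jap x ≤ 2 * x := by
  unfold jap
  exact Real.sqrt_le_iff.2 ⟨by linarith, by nlinarith⟩

lemma ptwise (p₁ s p₂ q₁ q₂ : ℝ) (x t : ℝ) (h1 : 1 ≤ t) (htx : t < x) :
    min (jap t ^ (-q₁) * (x - t) ^ (-p₁))
            (jap x ^ s * jap t ^ (-q₂) * (x - t) ^ (-p₂)) ≤
      (4 ^ |-q₁| * jap x ^ (-q₁)) * (x - t) ^ (-p₁) +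
      (4 ^ |-p₂| * 4 ^ |-q₂| * jap x ^ (s - p₂)) * t ^ (-q₂) := by
  have ht := jap_ge t
  have ht' := jap_le t h1
  have hx := jap_ge x
  have hx' := jap_le x (by linarith)
  have hX : 0 < jap x := by linarith
  have hT : 0 < jap t := by linarith
  have hd : 0 < x - t := by linarith
  have ht0 : 0 < t := by linarith
  rcases le_total (x / 2) t with h | h
  · refine (min_le_left _ _).trans ?_
    have := rpow_cmp (jap t) (jap x) (-q₁) hX (by linarith) (by linarith)
    have h3 : jap t ^ (-q₁) * (x - t) ^ (-p₁) ≤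
      (4 ^ |-q₁| * jap x ^ (-q₁)) * (x - t) ^ (-p₁) := by gcongr
    have : 0 ≤ (4 ^ |-p₂| * 4 ^ |-q₂| * jap x ^ (s - p₂)) * t ^ (-q₂) := by positivity
    linarith
  · refine (min_le_right _ _).trans ?_
    have a1 := rpow_cmp (jap t) t (-q₂) ht0 (by linarith) (by linarith)
    have a2 := rpow_cmp (x - t) (jap x) (-p₂) hX (by linarith) (by linarith)
    have h3 : jap x ^ s * jap t ^ (-q₂) * (x - t) ^ (-p₂) ≤
      jap x ^ s * (4 ^ |-q₂| * t ^ (-q₂)) * (4 ^ |-p₂| * jap x ^ (-p₂)) := by gcongr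
    have : 0 ≤ (4 ^ |-q₁| * jap x ^ (-q₁)) * (x - t) ^ (-p₁) := by positivity
    have e : jap x ^ (s - p₂) = jap x ^ s * jap x ^ (-p₂) := by
      rw [sub_eq_add_neg, Real.rpow_add hX]
    rw [e]
    linarith

lemma int1 (p₁ : ℝ) (hp₁ : p₁ < 1) (x₀ x : ℝ) (h0 : 1 ≤ x₀) (hx : x₀ ≤ x) :
    (∫ t in x₀..x, (x - t) ^ (-p₁)) ≤ 1 / (1 - p₁) * jap x ^ (1 - p₁) := by
  rw [intervalIntegral.integral_comp_sub_left (fun t => t ^ (-p₁)) x,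
    integral_rpow (Or.inl (by linarith))]
  have e : -p₁ + 1 = 1 - p₁ := by ring
  rw [e, sub_self, Real.zero_rpow (by linarith), sub_zero, one_div_mul_eq_div]
  have hj := jap_ge x
  have : 0 < 1 - p₁ := by linarith
  have : 0 ≤ x - x₀ := by linarith
  gcongr
  linarith

lemma int2 (q₂ : ℝ) (hq₂ : q₂ ≠ 1) (x₀ x : ℝ) (h0 : 1 ≤ x₀) (hx : x₀ ≤ x) :
    (∫ t in x₀..x, t ^ (-q₂)) ≤
      4 ^ |1 - q₂| / |1 - q₂| * max (jap x ^ (1 - q₂)) (jap x₀ ^ (1 - q₂)) := by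
  have hn : (0:ℝ) ∉ Set.uIcc x₀ x := by
    rw [Set.uIcc_of_le hx]; intro h; linarith [h.1]
  rw [integral_rpow (Or.inr ⟨fun h => hq₂ (by linarith), hn⟩)]
  have e : -q₂ + 1 = 1 - q₂ := by ring
  rw [e]
  have a1 := jap_ge x
  have a2 := jap_le x (by linarith)
  have a3 := jap_ge x₀
  have a4 := jap_le x₀ h0
  have b1 := rpow_cmp x (jap x) (1 - q₂) (by linarith) (by linarith) (by linarith)
  have b2 := rpow_cmp x₀ (jap x₀) (1 - q₂) (by linarith) (by linarith) (by linarith)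
  have hr : 1 - q₂ ≠ 0 := fun h => hq₂ (by linarith)
  have c1 : 0 ≤ x ^ (1 - q₂) := Real.rpow_nonneg (by linarith) _
  have c2 : 0 ≤ x₀ ^ (1 - q₂) := Real.rpow_nonneg (by linarith) _
  have h4 : (0:ℝ) < 4 ^ |1 - q₂| := by positivity
  set M := max (jap x ^ (1 - q₂)) (jap x₀ ^ (1 - q₂)) with hM
  have m1 := mul_le_mul_of_nonneg_left (le_max_left (jap x ^ (1 - q₂)) (jap x₀ ^ (1 - q₂))) h4.le
  have m2 := mul_le_mul_of_nonneg_left (le_max_right (jap x ^ (1 - q₂)) (jap x₀ ^ (1 - q₂))) h4.le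
  rw [← hM] at m1 m2
  refine (le_abs_self _).trans ?_
  rw [abs_div, div_mul_eq_mul_div]
  have : |x ^ (1 - q₂) - x₀ ^ (1 - q₂)| ≤ 4 ^ |1 - q₂| * M :=
    abs_le.2 ⟨by linarith, by linarith⟩
  gcongr

/-- Let `p₁ < 1`, `s ≥ 0`, `p₂, q₁, q₂ ∈ ℝ` and `q₂ ≠ 1`. There is `C > 0`,
depending only on the exponents, such that for all `x ≥ x₀ ≥ 1`:
`∫_{x₀}^{x} min(⟨t⟩^{−q₁}(x−t)^{−p₁}, ⟨x⟩^{s}⟨t⟩^{−q₂}(x−t)^{−p₂}) dt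
  ≤ C (⟨x⟩^{1−q₁−p₁} + ⟨x⟩^{s−p₂} max(⟨x⟩^{1−q₂}, ⟨x₀⟩^{1−q₂}))`. -/
theorem stmt8 (p₁ s p₂ q₁ q₂ : ℝ) (hp₁ : p₁ < 1) (hs : 0 ≤ s) (hq₂ : q₂ ≠ 1) :
    ∃ C : ℝ, 0 < C ∧ ∀ x₀ x : ℝ, 1 ≤ x₀ → x₀ ≤ x →
      (∫ t in x₀..x,
          min (jap t ^ (-q₁) * (x - t) ^ (-p₁))
            (jap x ^ s * jap t ^ (-q₂) * (x - t) ^ (-p₂))) ≤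
        C * (jap x ^ (1 - q₁ - p₁) +
          jap x ^ (s - p₂) * max (jap x ^ (1 - q₂)) (jap x₀ ^ (1 - q₂))) := by
  have hp : 0 < 1 - p₁ := by linarith
  have hr : 0 < |1 - q₂| := abs_pos.2 fun h => hq₂ (by linarith)
  obtain ⟨A, hA⟩ : ∃ A : ℝ, A = 4 ^ |-q₁| * (1 / (1 - p₁)) := ⟨_, rfl⟩
  obtain ⟨B, hB⟩ : ∃ B : ℝ, B = 4 ^ |-p₂| * 4 ^ |-q₂| * (4 ^ |1 - q₂| / |1 - q₂|) := ⟨_, rfl⟩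
  have hA0 : 0 < A := by rw [hA]; positivity
  have hB0 : 0 < B := by rw [hB]; positivity
  refine ⟨A + B, by positivity, fun x₀ x h0 hx => ?_⟩
  have hj := jap_ge x
  have hX : 0 < jap x := by linarith
  have hX0 : 0 < jap x₀ := by linarith [jap_ge x₀]
  have hn : (0:ℝ) ∉ Set.uIcc x₀ x := by
    rw [Set.uIcc_of_le hx]; intro h; linarith [h.1]
  have i1 : IntervalIntegrable (fun t => (x - t) ^ (-p₁)) volume x₀ x := by
    have := (intervalIntegral.intervalIntegrable_rpow' (a := x - x₀) (b := x - x)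
      (r := -p₁) (by linarith)).comp_sub_left x
    simpa using this
  have i2 : IntervalIntegrable (fun t : ℝ => t ^ (-q₂)) volume x₀ x :=
    intervalIntegral.intervalIntegrable_rpow (Or.inr hn)
  have j1 := i1.const_mul (4 ^ |-q₁| * jap x ^ (-q₁))
  have j2 := i2.const_mul (4 ^ |-p₂| * 4 ^ |-q₂| * jap x ^ (s - p₂))
  have key : (∫ t in x₀..x,
          min (jap t ^ (-q₁) * (x - t) ^ (-p₁))
            (jap x ^ s * jap t ^ (-q₂) * (x - t) ^ (-p₂))) ≤
      ∫ t in x₀..x, ((4 ^ |-q₁| * jap x ^ (-q₁)) * (x - t) ^ (-p₁) +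
      (4 ^ |-p₂| * 4 ^ |-q₂| * jap x ^ (s - p₂)) * t ^ (-q₂)) := by
    have jj := (j1.add j2)
    rw [intervalIntegrable_iff_integrableOn_Ioo_of_le hx] at jj
    rw [intervalIntegral.integral_of_le hx, intervalIntegral.integral_of_le hx,
      integral_Ioc_eq_integral_Ioo, integral_Ioc_eq_integral_Ioo]
    refine integral_mono_of_nonneg ?_ jj ?_
    · filter_upwards [ae_restrict_mem measurableSet_Ioo] with t ht
      have : 0 < x - t := by linarith [ht.2]
      have : 0 < jap t := by linarith [ht.1, jap_ge t]
      exact le_min (by positivity) (by positivity)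
    · filter_upwards [ae_restrict_mem measurableSet_Ioo] with t ht
      exact ptwise p₁ s p₂ q₁ q₂ x t (by linarith [ht.1]) ht.2
  refine key.trans ?_
  rw [intervalIntegral.integral_add j1 j2, intervalIntegral.integral_const_mul,
    intervalIntegral.integral_const_mul]
  have k1 := mul_le_mul_of_nonneg_left (int1 p₁ hp₁ x₀ x h0 hx)
    (by positivity : 0 ≤ 4 ^ |-q₁| * jap x ^ (-q₁))
  have k2 := mul_le_mul_of_nonneg_left (int2 q₂ hq₂ x₀ x h0 hx)
    (by positivity : 0 ≤ 4 ^ |-p₂| * 4 ^ |-q₂| * jap x ^ (s - p₂))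
  have e : jap x ^ (1 - q₁ - p₁) = jap x ^ (-q₁) * jap x ^ (1 - p₁) := by
    rw [← Real.rpow_add hX]; congr 1; ring
  have hM : 0 ≤ max (jap x ^ (1 - q₂)) (jap x₀ ^ (1 - q₂)) :=
    le_max_of_le_left (by positivity)
  generalize max (jap x ^ (1 - q₂)) (jap x₀ ^ (1 - q₂)) = M at *
  have l1 : 0 ≤ B * jap x ^ (1 - q₁ - p₁) := by positivity
  have l2 : 0 ≤ A * (jap x ^ (s - p₂) * M) := by positivity
  have m1 : A * jap x ^ (1 - q₁ - p₁) =
      4 ^ |-q₁| * jap x ^ (-q₁) * (1 / (1 - p₁) * jap x ^ (1 - p₁)) := by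
    rw [e, hA]; ring
  have m2 : B * (jap x ^ (s - p₂) * M) = 4 ^ |-p₂| * 4 ^ |-q₂| * jap x ^ (s - p₂) *
      (4 ^ |1 - q₂| / |1 - q₂| * M) := by
    rw [hB]; ring
  linarith
end

section
/- Let 0 ≤ γ ≤ 1 and m ∈ ℕ. There exists a constant C > 0 such that for all x > 0, every integrable function f : ℝ → ℝ with ∫_ℝ |z|^γ·|f(z)| dz < ∞, and every y ∈ ℝ, the Poisson kernel P_x(y) = x/(π(x²+y²)) satisfies | ∫_ℝ P_x^{(m)}(y−z)·f(z) dz − (∫_ℝ f(z) dz)·P_x^{(m)}(y) | ≤ C · x^{−1−m−γ} · ∫_ℝ |z|^γ·|f(z)| dz, where P_x^{(m)} denotes the m-th derivative of P_x with respect to y. -/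
open MeasureTheory Real

theorem aux_ne {x : ℝ} (hx : 0 < x) (w : ℝ) : (x : ℂ) + Complex.I * w ≠ 0 := by
  intro h
  have := congrArg Complex.re h
  simp at this
  linarith

theorem aux_norm {x : ℝ} (hx : 0 < x) (w : ℝ) : x ≤ ‖(x : ℂ) + Complex.I * w‖ := by
  have := Complex.abs_re_le_norm ((x : ℂ) + Complex.I * w)
  simp at this
  exact (le_abs_self x).trans this

/-- Complex representation of the derivatives. -/
noncomputable def auxG (x : ℝ) (m : ℕ) (w : ℝ) : ℝ :=
  (((-Complex.I) ^ m * (m.factorial : ℂ) / π) * (((x : ℂ) + Complex.I * w)⁻¹) ^ (m + 1)).re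

theorem auxG_zero {x : ℝ} (w : ℝ) :
    x / (π * (x ^ 2 + w ^ 2)) = auxG x 0 w := by
  unfold auxG
  have : ((-Complex.I) ^ 0 * ((Nat.factorial 0 : ℕ) : ℂ) / π) = ((1 / π : ℝ) : ℂ) := by
    push_cast; simp
  rw [this, Complex.re_ofReal_mul, zero_add, pow_one, Complex.inv_re]
  have h2 : Complex.normSq ((x : ℂ) + Complex.I * w) = x ^ 2 + w ^ 2 := by
    rw [Complex.normSq_apply]; simp; ring
  rw [h2]
  simp
  field_simp

theorem auxG_deriv {x : ℝ} (hx : 0 < x) (m : ℕ) (w : ℝ) :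
    HasDerivAt (auxG x m) (auxG x (m + 1) w) w := by
  have h0 : HasDerivAt (fun w : ℝ => (x : ℂ) + Complex.I * w) Complex.I w := by
    simpa using (((Complex.ofRealCLM.hasDerivAt (x := w)).const_mul Complex.I).const_add (x : ℂ))
  have h1 := ((h0.fun_inv (aux_ne hx w)).fun_pow (m + 1)).const_mul
    ((-Complex.I) ^ m * (m.factorial : ℂ) / π)
  have h2 := (Complex.reCLM.hasFDerivAt).comp_hasDerivAt w h1
  refine h2.congr_deriv ?_
  unfold auxG
  rw [Complex.reCLM_apply]
  congr 1
  have := aux_ne hx w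
  rw [Nat.factorial_succ]
  push_cast
  simp only [Nat.add_sub_cancel, pow_succ (-Complex.I), inv_pow]
  field_simp
  ring

theorem aux_iter {x : ℝ} (hx : 0 < x) (m : ℕ) :
    iteratedDeriv m (fun w : ℝ => x / (π * (x ^ 2 + w ^ 2))) = auxG x m := by
  induction m with
  | zero => rw [iteratedDeriv_zero]; funext w; exact auxG_zero w
  | succ k ih =>
    rw [iteratedDeriv_succ, ih]
    funext w
    exact (auxG_deriv hx k w).deriv

theorem auxG_bound {x : ℝ} (hx : 0 < x) (m : ℕ) (w : ℝ) :
    |auxG x m w| ≤ m.factorial * (x⁻¹) ^ (m + 1) := by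
  unfold auxG
  refine (Complex.abs_re_le_norm _).trans ?_
  rw [norm_mul, norm_pow, norm_inv]
  have h1 : ‖((-Complex.I) ^ m * (m.factorial : ℂ) / π)‖ ≤ m.factorial := by
    simp only [norm_div, norm_mul, norm_pow, norm_neg, Complex.norm_I, one_pow, one_mul,
      Complex.norm_natCast, Complex.norm_real, Real.norm_eq_abs, abs_of_pos pi_pos]
    apply div_le_self (by positivity)
    linarith [pi_gt_three]
  have := aux_norm hx w
  gcongr

theorem auxG_diff {x : ℝ} (hx : 0 < x) (m : ℕ) {γ : ℝ} (hγ0 : 0 ≤ γ) (hγ1 : γ ≤ 1) (y z : ℝ) :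
    |auxG x m (y - z) - auxG x m y| ≤
      2 * (m + 1).factorial * x ^ (-1 - (m : ℝ) - γ) * |z| ^ γ := by
  have hfac : ((m.factorial : ℕ) : ℝ) ≤ (m + 1).factorial := by
    exact_mod_cast Nat.factorial_le (Nat.le_succ m)
  have hx' : x ^ (-1 - (m : ℝ) - γ) * |z| ^ γ = (x⁻¹) ^ (m + 1) * (|z| / x) ^ γ := by
    rw [rpow_sub hx, div_rpow (abs_nonneg z) hx.le]
    have : x ^ (-1 - (m : ℝ)) = (x⁻¹) ^ (m + 1) := by
      rw [show -1 - (m : ℝ) = -((m + 1 : ℕ) : ℝ) by push_cast; ring, rpow_neg hx.le,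
        rpow_natCast, inv_pow]
    rw [this]; ring
  rw [mul_assoc, hx']
  have hp : 0 < (x⁻¹) ^ (m + 1) := by positivity
  have ht : 0 ≤ |z| / x := by positivity
  rcases le_total (|z| / x) 1 with h | h
  · have h3 : |z| / x ≤ (|z| / x) ^ γ := by
      rcases ht.eq_or_lt with h0 | h0
      · rw [← h0]; positivity
      · simpa using rpow_le_rpow_of_exponent_ge h0 h hγ1
    have h4 := Convex.norm_image_sub_le_of_norm_hasDerivWithin_le (𝕜 := ℝ)
      (f := auxG x m) (f' := auxG x (m + 1)) (s := Set.univ) (x := y) (y := y - z)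
      (fun w _ => (auxG_deriv hx m w).hasDerivWithinAt)
      (fun w _ => auxG_bound hx (m + 1) w) convex_univ trivial trivial
    simp only [Real.norm_eq_abs, sub_sub_cancel_left, abs_neg] at h4
    refine h4.trans ?_
    calc ((m + 1).factorial : ℝ) * x⁻¹ ^ (m + 1 + 1) * |z|
        = 1 * (m + 1).factorial * (x⁻¹ ^ (m + 1) * (|z| / x)) := by ring
      _ ≤ _ := by gcongr; norm_num
  · have h3 : 1 ≤ (|z| / x) ^ γ := one_le_rpow h hγ0
    calc |auxG x m (y - z) - auxG x m y| ≤ |auxG x m (y - z)| + |auxG x m y| := abs_sub _ _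
      _ ≤ m.factorial * (x⁻¹) ^ (m + 1) + m.factorial * (x⁻¹) ^ (m + 1) :=
        add_le_add (auxG_bound hx m _) (auxG_bound hx m _)
      _ = 2 * m.factorial * ((x⁻¹) ^ (m + 1) * 1) := by ring
      _ ≤ _ := by gcongr

/-- Let `0 ≤ γ ≤ 1` and `m ∈ ℕ`. There is `C > 0` such that for all
`x > 0`, every integrable `f : ℝ → ℝ` with `∫ |z|^γ |f z| dz < ∞`, and every `y ∈ ℝ`,
the `m`-th `y`-derivative `P_x^{(m)}` of the Poisson kernel `P_x(y) = x/(π(x²+y²))`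
satisfies `|∫ P_x^{(m)}(y−z) f(z) dz − (∫ f) P_x^{(m)}(y)| ≤ C x^{−1−m−γ} ∫ |z|^γ |f z| dz`. -/
theorem stmt11 (γ : ℝ) (hγ0 : 0 ≤ γ) (hγ1 : γ ≤ 1) (m : ℕ) :
    ∃ C : ℝ, 0 < C ∧ ∀ x : ℝ, 0 < x →
      ∀ f : ℝ → ℝ, Integrable f (volume : Measure ℝ) →
        Integrable (fun z : ℝ => |z| ^ γ * |f z|) (volume : Measure ℝ) →
        ∀ y : ℝ,
          |(∫ z : ℝ, iteratedDeriv m (fun w : ℝ => x / (π * (x ^ 2 + w ^ 2))) (y - z) * f z) -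
              (∫ z : ℝ, f z) * iteratedDeriv m (fun w : ℝ => x / (π * (x ^ 2 + w ^ 2))) y| ≤
            C * x ^ (-1 - (m : ℝ) - γ) * ∫ z : ℝ, |z| ^ γ * |f z| := by
  refine ⟨2 * (m + 1).factorial, by positivity, ?_⟩
  intro x hx f hf hg y
  rw [aux_iter hx]
  have hc : Continuous (auxG x m) :=
    continuous_iff_continuousAt.2 fun w => (auxG_deriv hx m w).continuousAt
  have hi : Integrable (fun z => auxG x m (y - z) * f z) :=
    hf.bdd_mul (c := m.factorial * (x⁻¹) ^ (m + 1))
      (hc.comp (continuous_const.sub continuous_id)).aestronglyMeasurable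
      (Filter.Eventually.of_forall fun z => auxG_bound hx m (y - z))
  rw [← integral_mul_const, ← integral_sub hi (hf.mul_const _), ← integral_const_mul]
  rw [← Real.norm_eq_abs]
  refine norm_integral_le_of_norm_le (hg.const_mul _) (Filter.Eventually.of_forall fun z => ?_)
  rw [show auxG x m (y - z) * f z - f z * auxG x m y
    = (auxG x m (y - z) - auxG x m y) * f z by ring, Real.norm_eq_abs, abs_mul, ← mul_assoc]
  exact mul_le_mul_of_nonneg_right (auxG_diff hx m hγ0 hγ1 y z) (abs_nonneg _)
end

section
/- Let 0 ≤ γ ≤ 1 and m ∈ ℕ. There exists a constant C > 0 such that for all x > 0, every integrable function f : ℝ → ℝ with ∫_ℝ |z|^γ·|f(z)| dz < ∞, and every y ∈ ℝ, the conjugate Poisson kernel Q_x(y) = y/(π(x²+y²)) satisfies | ∫_ℝ Q_x^{(m)}(y−z)·f(z) dz − (∫_ℝ f(z) dz)·Q_x^{(m)}(y) | ≤ C · x^{−1−m−γ} · ∫_ℝ |z|^γ·|f(z)| dz, where Q_x^{(m)} denotes the m-th derivative of Q_x with respect to y. -/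
open MeasureTheory Real

lemma ne_aux {x : ℝ} (hx : 0 < x) (w : ℝ) : (w : ℂ) + x * Complex.I ≠ 0 := by
  intro h
  have := congrArg Complex.im h
  simp at this
  exact hx.ne' this

lemma norm_aux {x : ℝ} (hx : 0 < x) (w : ℝ) : x ≤ ‖(w : ℂ) + x * Complex.I‖ := by
  have := Complex.abs_im_le_norm ((w : ℂ) + x * Complex.I)
  simp [abs_of_pos hx] at this
  exact this

lemma deriv_aux {x : ℝ} (hx : 0 < x) (m : ℕ) (w : ℝ) :
    HasDerivAt (fun w : ℝ => (((-1) ^ m * (m.factorial : ℂ) / π *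
      (((w : ℂ) + x * Complex.I) ^ (m + 1))⁻¹)).re)
      ((((-1) ^ (m + 1) * ((m + 1).factorial : ℂ) / π *
      (((w : ℂ) + x * Complex.I) ^ (m + 2))⁻¹)).re) w := by
  have hne := ne_aux hx w
  have hpi : (π : ℂ) ≠ 0 := by exact_mod_cast pi_ne_zero
  have h1 : HasDerivAt (fun z : ℂ => (-1) ^ m * (m.factorial : ℂ) / π *
      ((z + x * Complex.I) ^ (m + 1))⁻¹) ((-1) ^ (m + 1) * ((m + 1).factorial : ℂ) / π *
      (((w : ℂ) + x * Complex.I) ^ (m + 2))⁻¹) (w : ℂ) := by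
    have h := ((((hasDerivAt_id (w : ℂ)).add_const (x * Complex.I)).pow (m + 1)).inv
      (by simpa using pow_ne_zero (m+1) hne)).const_mul ((-1) ^ m * (m.factorial : ℂ) / π)
    refine h.congr_deriv ?_
    simp only [id, Nat.factorial_succ, Pi.pow_apply, Nat.add_sub_cancel]
    push_cast
    field_simp
    ring
  exact h1.real_of_complex

lemma iter_aux {x : ℝ} (hx : 0 < x) (m : ℕ) :
    iteratedDeriv m (fun w : ℝ => w / (π * (x ^ 2 + w ^ 2))) =
    fun w : ℝ => (((-1) ^ m * (m.factorial : ℂ) / π *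
      (((w : ℂ) + x * Complex.I) ^ (m + 1))⁻¹)).re := by
  induction m with
  | zero =>
    rw [iteratedDeriv_zero]
    funext w
    have h : ((-1) ^ 0 * ((0:ℕ).factorial : ℂ) / π * (((w : ℂ) + x * Complex.I) ^ (0 + 1))⁻¹)
      = ((1 / π : ℝ) : ℂ) * ((w : ℂ) + x * Complex.I)⁻¹ := by simp
    rw [h, Complex.re_ofReal_mul, Complex.inv_re]
    simp [Complex.normSq_apply]
    have : x ^ 2 + w ^ 2 ≠ 0 := by positivity
    have : w * w + x * x ≠ 0 := by nlinarith [mul_pos hx hx, mul_self_nonneg w]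
    have := pi_ne_zero
    field_simp
    ring
  | succ m ih =>
    rw [iteratedDeriv_succ, ih]
    funext w
    exact (deriv_aux hx m w).deriv

lemma bound_aux {x : ℝ} (hx : 0 < x) (m : ℕ) (w : ℝ) :
    |iteratedDeriv m (fun w : ℝ => w / (π * (x ^ 2 + w ^ 2))) w| ≤
      m.factorial / x ^ (m + 1) := by
  rw [iter_aux hx]
  refine (Complex.abs_re_le_norm _).trans ?_
  have h1 := norm_aux hx w
  have hp : (1:ℝ) ≤ π := by linarith [pi_gt_three]
  rw [norm_mul, norm_div, norm_mul, norm_pow, norm_neg, norm_one, one_pow, one_mul,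
    norm_inv, norm_pow, Complex.norm_natCast, Complex.norm_real, Real.norm_of_nonneg pi_pos.le,
    div_eq_mul_inv (m.factorial : ℝ) (x ^ (m + 1))]
  gcongr
  exact div_le_self (by positivity) hp

lemma diff_aux {x : ℝ} (hx : 0 < x) (m : ℕ) (y z : ℝ) :
    |iteratedDeriv m (fun w : ℝ => w / (π * (x ^ 2 + w ^ 2))) (y - z) -
      iteratedDeriv m (fun w : ℝ => w / (π * (x ^ 2 + w ^ 2))) y| ≤
      (m + 1).factorial / x ^ (m + 2) * |z| := by
  have h := Convex.norm_image_sub_le_of_norm_hasDerivWithin_le (s := Set.univ)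
    (f := iteratedDeriv m (fun w : ℝ => w / (π * (x ^ 2 + w ^ 2))))
    (f' := iteratedDeriv (m + 1) (fun w : ℝ => w / (π * (x ^ 2 + w ^ 2))))
    (C := (m + 1).factorial / x ^ (m + 2)) (x := y) (y := y - z)
    (fun w _ => by
      rw [iter_aux hx, iter_aux hx]
      exact (deriv_aux hx m w).hasDerivWithinAt)
    (fun w _ => bound_aux hx (m + 1) w) convex_univ trivial trivial
  simpa [Real.norm_eq_abs] using h

lemma holder_aux {γ : ℝ} (hγ0 : 0 ≤ γ) (hγ1 : γ ≤ 1) {x : ℝ} (hx : 0 < x) (m : ℕ) (y z : ℝ) :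
    |iteratedDeriv m (fun w : ℝ => w / (π * (x ^ 2 + w ^ 2))) (y - z) -
      iteratedDeriv m (fun w : ℝ => w / (π * (x ^ 2 + w ^ 2))) y| ≤
      2 * (m + 1).factorial * x ^ (-1 - (m : ℝ) - γ) * |z| ^ γ := by
  have hr : x ^ (-1 - (m : ℝ) - γ) * |z| ^ γ = (x ^ (m + 1))⁻¹ * (|z| / x) ^ γ := by
    rw [Real.div_rpow (abs_nonneg z) hx.le, Real.rpow_sub hx, ← Real.rpow_natCast,
      ← Real.rpow_neg hx.le]
    have : -1 - (m : ℝ) = -((m + 1 : ℕ) : ℝ) := by push_cast; ring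
    rw [this]
    ring
  rw [mul_assoc, hr]
  have hF : (1:ℝ) ≤ (m + 1).factorial := by exact_mod_cast Nat.one_le_iff_ne_zero.2 (Nat.factorial_ne_zero _)
  have ht0 : 0 ≤ |z| / x := by positivity
  have hxp : 0 < (x ^ (m + 1))⁻¹ := by positivity
  rcases le_total (|z| / x) 1 with ht | ht
  · have h1 : |z| / x ≤ (|z| / x) ^ γ := by
      simpa using Real.rpow_le_rpow_of_exponent_ge' ht0 ht hγ0 hγ1
    calc _ ≤ _ := diff_aux hx m y z
      _ = (m + 1).factorial * ((x ^ (m + 1))⁻¹ * (|z| / x)) := by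
        field_simp
        ring
      _ ≤ (m + 1).factorial * ((x ^ (m + 1))⁻¹ * (|z| / x) ^ γ) := by gcongr
      _ ≤ 2 * (m + 1).factorial * ((x ^ (m + 1))⁻¹ * (|z| / x) ^ γ) := by
        gcongr; linarith
  · have h1 : 1 ≤ (|z| / x) ^ γ := Real.one_le_rpow ht hγ0
    have hfac : (m.factorial : ℝ) ≤ (m + 1).factorial := by
      exact_mod_cast Nat.factorial_le (Nat.le_succ m)
    calc _ ≤ _ := abs_sub _ _
      _ ≤ m.factorial / x ^ (m + 1) + m.factorial / x ^ (m + 1) :=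
        add_le_add (bound_aux hx m _) (bound_aux hx m _)
      _ = 2 * m.factorial * ((x ^ (m + 1))⁻¹ * 1) := by ring
      _ ≤ 2 * (m + 1).factorial * ((x ^ (m + 1))⁻¹ * (|z| / x) ^ γ) := by gcongr


/-- Let `0 ≤ γ ≤ 1` and `m ∈ ℕ`. There is `C > 0` such that for all
`x > 0`, every integrable `f : ℝ → ℝ` with `∫ |z|^γ |f z| dz < ∞`, and every `y ∈ ℝ`,
the `m`-th `y`-derivative `Q_x^{(m)}` of the conjugate Poisson kernel
`Q_x(y) = y/(π(x²+y²))` satisfies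
`|∫ Q_x^{(m)}(y−z) f(z) dz − (∫ f) Q_x^{(m)}(y)| ≤ C x^{−1−m−γ} ∫ |z|^γ |f z| dz`. -/
theorem stmt12 (γ : ℝ) (hγ0 : 0 ≤ γ) (hγ1 : γ ≤ 1) (m : ℕ) :
    ∃ C : ℝ, 0 < C ∧ ∀ x : ℝ, 0 < x →
      ∀ f : ℝ → ℝ, Integrable f (volume : Measure ℝ) →
        Integrable (fun z : ℝ => |z| ^ γ * |f z|) (volume : Measure ℝ) →
        ∀ y : ℝ,
          |(∫ z : ℝ, iteratedDeriv m (fun w : ℝ => w / (π * (x ^ 2 + w ^ 2))) (y - z) * f z) -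
              (∫ z : ℝ, f z) * iteratedDeriv m (fun w : ℝ => w / (π * (x ^ 2 + w ^ 2))) y| ≤
            C * x ^ (-1 - (m : ℝ) - γ) * ∫ z : ℝ, |z| ^ γ * |f z| := by
  refine ⟨2 * (m + 1).factorial, by positivity, ?_⟩
  intro x hx f hf hg y
  have hc : Continuous (iteratedDeriv m (fun w : ℝ => w / (π * (x ^ 2 + w ^ 2)))) := by
    rw [iter_aux hx]
    exact continuous_iff_continuousAt.2 fun w => (deriv_aux hx m w).continuousAt
  have hH := holder_aux hγ0 hγ1 hx m y
  have hB := bound_aux hx m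
  generalize iteratedDeriv m (fun w : ℝ => w / (π * (x ^ 2 + w ^ 2))) = q at *
  have hi : Integrable (fun z => q (y - z) * f z) :=
    hf.bdd_mul (c := m.factorial / x ^ (m + 1))
      (hc.comp (continuous_const.sub continuous_id)).aestronglyMeasurable
      (Filter.Eventually.of_forall fun z => hB (y - z))
  rw [← integral_mul_const, ← integral_sub hi (hf.mul_const _), ← integral_const_mul,
    ← Real.norm_eq_abs]
  refine norm_integral_le_of_norm_le (hg.const_mul _) (Filter.Eventually.of_forall fun z => ?_)
  have : q (y - z) * f z - f z * q y = (q (y - z) - q y) * f z := by ring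
  rw [this, Real.norm_eq_abs, abs_mul, ← mul_assoc]
  exact mul_le_mul_of_nonneg_right (hH z) (abs_nonneg _)
end

section
/- For every m ∈ ℕ there exists a constant C_m > 0 such that for all x₀ ≥ 1 and all x ≥ 2x₀, the functions g(y) = (1/π)·( (x−x₀)/((x−x₀)²+y²) − x/(x²+y²) ) and g̃(y) = (1/π)·( y/((x−x₀)²+y²) − y/(x²+y²) ) satisfy sup_{y ∈ ℝ} |g^{(m)}(y)| ≤ C_m · ⟨x⟩^{−m−2} · ⟨x₀⟩ and sup_{y ∈ ℝ} |g̃^{(m)}(y)| ≤ C_m · ⟨x⟩^{−m−2} · ⟨x₀⟩, where g^{(m)}, g̃^{(m)} denote m-th derivatives with respect to y. -/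
open MeasureTheory Real

lemma norm_pow_sub_pow_aux (u v : ℂ) (r : ℝ) (hr : 0 ≤ r) (hu : ‖u‖ ≤ r) (hv : ‖v‖ ≤ r) (n : ℕ) :
    ‖u ^ (n + 1) - v ^ (n + 1)‖ ≤ (n + 1) * r ^ n * ‖u - v‖ := by
  induction n with
  | zero => simp
  | succ n ih =>
    have h1 : u ^ (n + 1 + 1) - v ^ (n + 1 + 1)
        = u * (u ^ (n + 1) - v ^ (n + 1)) + (u - v) * v ^ (n + 1) := by ring
    rw [h1]
    have hvp : ‖v‖ ^ (n + 1) ≤ r ^ (n + 1) := pow_le_pow_left₀ (norm_nonneg _) hv _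
    calc _ ≤ ‖u * (u ^ (n + 1) - v ^ (n + 1))‖ + ‖(u - v) * v ^ (n + 1)‖ := norm_add_le _ _
      _ = ‖u‖ * ‖u ^ (n + 1) - v ^ (n + 1)‖ + ‖u - v‖ * ‖v‖ ^ (n + 1) := by
        rw [norm_mul, norm_mul, norm_pow]
      _ ≤ r * ((n + 1) * r ^ n * ‖u - v‖) + ‖u - v‖ * r ^ (n + 1) := by gcongr
      _ = _ := by push_cast; ring

lemma lin_ne (a y : ℝ) (ha : 0 < a) : (a : ℂ) + y * Complex.I ≠ 0 := by
  intro h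
  have := congrArg Complex.re h
  simp at this
  exact ha.ne' this

/-- the `m`-th derivative of `1 / (a + i y)`. -/
noncomputable def kerD (m : ℕ) (a y : ℝ) : ℂ :=
  (-Complex.I) ^ m * (m.factorial : ℂ) * (((a : ℂ) + y * Complex.I)⁻¹) ^ (m + 1)

lemma kerD_hasDeriv (m : ℕ) (a y : ℝ) (ha : 0 < a) :
    HasDerivAt (kerD m a) (kerD (m + 1) a y) y := by
  have h0 : HasDerivAt (fun y : ℝ => (a : ℂ) + y * Complex.I) (1 * Complex.I) y :=
    ((Complex.ofRealCLM.hasDerivAt (x := y)).mul_const Complex.I).const_add (a : ℂ)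
  have hne := lin_ne a y ha
  have h1 := ((h0.fun_inv hne).fun_pow (m + 1)).const_mul ((-Complex.I) ^ m * (m.factorial : ℂ))
  have e : kerD (m + 1) a y = (-Complex.I) ^ m * (m.factorial : ℂ) *
      (((m + 1 : ℕ) : ℂ) * ((a : ℂ) + y * Complex.I)⁻¹ ^ (m + 1 - 1) *
        (-(1 * Complex.I) / ((a : ℂ) + y * Complex.I) ^ 2)) := by
    unfold kerD
    rw [Nat.factorial_succ, div_eq_mul_inv, ← inv_pow]
    push_cast
    ring
  rw [e]
  exact h1

lemma iter_aux_s13 (L : ℂ →L[ℝ] ℝ) (a b : ℝ) (ha : 0 < a) (hb : 0 < b) (m : ℕ) :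
    iteratedDeriv m (fun w => 1 / π * L (kerD 0 a w - kerD 0 b w))
      = fun w => 1 / π * L (kerD m a w - kerD m b w) := by
  induction m with
  | zero => simp
  | succ m ih =>
    rw [iteratedDeriv_succ, ih]
    funext y
    have h := (kerD_hasDeriv m a y ha).sub (kerD_hasDeriv m b y hb)
    exact ((L.hasFDerivAt.comp_hasDerivAt y h).const_mul (1 / π)).deriv

lemma norm_inv_le (a y : ℝ) (ha : 0 < a) : ‖((a : ℂ) + y * Complex.I)⁻¹‖ ≤ a⁻¹ := by
  rw [norm_inv]
  apply inv_anti₀ ha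
  have := Complex.abs_re_le_norm ((a : ℂ) + y * Complex.I)
  simp at this
  exact (le_abs_self a).trans this

lemma kerD_bound (m : ℕ) (x₀ x y : ℝ) (h0 : 1 ≤ x₀) (hx : 2 * x₀ ≤ x) :
    ‖kerD m (x - x₀) y - kerD m x y‖
      ≤ m.factorial * (m + 1) * 4 ^ (m + 2) * jap x ^ (-(m : ℝ) - 2) * jap x₀ := by
  have ha : 0 < x - x₀ := by linarith
  have hb : 0 < x := by linarith
  have hab : x⁻¹ ≤ (x - x₀)⁻¹ := inv_anti₀ ha (by linarith)
  have hu := norm_inv_le (x - x₀) y ha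
  have hv0 := norm_inv_le x y hb
  have hv := hv0.trans hab
  have hne1 := lin_ne (x - x₀) y ha
  have hne2 := lin_ne x y hb
  set r := (x - x₀)⁻¹ with hr
  have hr0 : 0 < r := inv_pos.mpr ha
  set u := (((x - x₀ : ℝ) : ℂ) + y * Complex.I)⁻¹ with hudef
  set v := ((x : ℂ) + y * Complex.I)⁻¹ with hvdef
  have huv : u - v = (x₀ : ℂ) * (u * v) := by
    rw [hudef, hvdef]
    field_simp
    push_cast
    ring
  have huvn : ‖u - v‖ ≤ x₀ * (r * r) := by
    rw [huv, norm_mul, norm_mul, Complex.norm_real, Real.norm_of_nonneg (by linarith)]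
    gcongr
  have hj : 0 < jap x := Real.sqrt_pos.mpr (by positivity)
  have hj4 : jap x ≤ 4 * (x - x₀) := by
    unfold jap
    rw [Real.sqrt_le_left (by linarith)]
    nlinarith
  have hj0 : x₀ ≤ jap x₀ := Real.le_sqrt_of_sq_le (by linarith)
  have hrj : r ≤ 4 * (jap x)⁻¹ := by
    rw [hr, ← div_eq_mul_inv, inv_eq_one_div, div_le_div_iff₀ ha hj]
    linarith
  have hpow : jap x ^ (-(m : ℝ) - 2) = ((jap x)⁻¹) ^ (m + 2) := by
    rw [show (-(m : ℝ) - 2) = -((m + 2 : ℕ) : ℝ) by push_cast; ring, Real.rpow_neg hj.le,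
      Real.rpow_natCast, inv_pow]
  have hk : kerD m (x - x₀) y - kerD m x y
      = (-Complex.I) ^ m * (m.factorial : ℂ) * (u ^ (m + 1) - v ^ (m + 1)) := by
    unfold kerD
    rw [← hudef, ← hvdef]
    ring
  rw [hk, hpow, norm_mul, norm_mul, norm_pow, norm_neg, Complex.norm_I, one_pow, one_mul,
    Complex.norm_natCast]
  calc _ ≤ (m.factorial : ℝ) * ((m + 1) * r ^ m * (x₀ * (r * r))) := by
        gcongr
        exact (norm_pow_sub_pow_aux u v r hr0.le hu hv m).trans (by gcongr)
    _ = m.factorial * (m + 1) * r ^ (m + 2) * x₀ := by ring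
    _ ≤ m.factorial * (m + 1) * (4 * (jap x)⁻¹) ^ (m + 2) * jap x₀ := by gcongr
    _ = _ := by rw [mul_pow]; ring

lemma final_aux (L : ℂ →L[ℝ] ℝ) (hL : ∀ z, |L z| ≤ ‖z‖) (m : ℕ) (x₀ x y : ℝ)
    (h0 : 1 ≤ x₀) (hx : 2 * x₀ ≤ x) :
    |iteratedDeriv m (fun w => 1 / π * L (kerD 0 (x - x₀) w - kerD 0 x w)) y|
      ≤ m.factorial * (m + 1) * 4 ^ (m + 2) * jap x ^ (-(m : ℝ) - 2) * jap x₀ := by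
  rw [iter_aux_s13 L _ _ (by linarith) (by linarith)]
  refine le_trans ?_ (kerD_bound m x₀ x y h0 hx)
  rw [abs_mul]
  have h1 : |1 / π| ≤ 1 := by
    rw [abs_of_pos (by positivity), div_le_one Real.pi_pos]
    linarith [Real.pi_gt_three]
  calc _ ≤ 1 * |L (kerD m (x - x₀) y - kerD m x y)| := by gcongr
    _ ≤ _ := by rw [one_mul]; exact hL _

lemma ker_re (a y : ℝ) : (kerD 0 a y).re = a / (a ^ 2 + y ^ 2) := by
  simp [kerD, Complex.inv_re, Complex.normSq_apply, pow_two]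

lemma ker_im (a y : ℝ) : (kerD 0 a y).im = -(y / (a ^ 2 + y ^ 2)) := by
  simp [kerD, Complex.inv_im, Complex.normSq_apply, pow_two, neg_div]

/-- For every `m ∈ ℕ` there is `C_m > 0` such that for all `x₀ ≥ 1` and
`x ≥ 2x₀`, the differences of Poisson kernels
`g(y) = (1/π)((x−x₀)/((x−x₀)²+y²) − x/(x²+y²))` and
`g̃(y) = (1/π)(y/((x−x₀)²+y²) − y/(x²+y²))` satisfy
`sup_y |g^{(m)}(y)| ≤ C_m ⟨x⟩^{−m−2} ⟨x₀⟩` and `sup_y |g̃^{(m)}(y)| ≤ C_m ⟨x⟩^{−m−2} ⟨x₀⟩`. -/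
theorem stmt13 (m : ℕ) :
    ∃ C : ℝ, 0 < C ∧ ∀ x₀ x : ℝ, 1 ≤ x₀ → 2 * x₀ ≤ x →
      (∀ y : ℝ,
        |iteratedDeriv m
            (fun w : ℝ => (1 / π) * ((x - x₀) / ((x - x₀) ^ 2 + w ^ 2) - x / (x ^ 2 + w ^ 2)))
            y| ≤ C * jap x ^ (-(m : ℝ) - 2) * jap x₀) ∧
      (∀ y : ℝ,
        |iteratedDeriv m
            (fun w : ℝ => (1 / π) * (w / ((x - x₀) ^ 2 + w ^ 2) - w / (x ^ 2 + w ^ 2)))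
            y| ≤ C * jap x ^ (-(m : ℝ) - 2) * jap x₀) := by
  refine ⟨m.factorial * (m + 1) * 4 ^ (m + 2), by positivity, ?_⟩
  intro x₀ x h0 hx
  constructor
  · intro y
    have h := final_aux Complex.reCLM Complex.abs_re_le_norm m x₀ x y h0 hx
    simpa only [Complex.reCLM_apply, Complex.sub_re, ker_re] using h
  · intro y
    have h := final_aux (-Complex.imCLM) (fun z => by simpa using Complex.abs_im_le_norm z)
      m x₀ x y h0 hx
    have e : (fun w : ℝ => 1 / π * (-Complex.imCLM) (kerD 0 (x - x₀) w - kerD 0 x w))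
        = fun w : ℝ => (1 / π) * (w / ((x - x₀) ^ 2 + w ^ 2) - w / (x ^ 2 + w ^ 2)) := by
      funext w
      rw [neg_apply, Complex.imCLM_apply, Complex.sub_im, ker_im, ker_im]
      ring
    rwa [e] at h
end

section
/- For every m ∈ ℕ there exists a constant C_m > 0 such that for all x₀ ≥ 1 and all x ≥ 2x₀, the function f(y) = e^{−y²/(4(x−x₀))}/√(4π(x−x₀)) − e^{−y²/(4x)}/√(4πx) satisfies: sup_{y ∈ ℝ} |f^{(m)}(y)| ≤ C_m · ⟨x⟩^{−(3+m)/2} · ⟨x₀⟩, ∫_ℝ |f^{(m)}(y)| dy ≤ C_m · ⟨x⟩^{−(2+m)/2} · ⟨x₀⟩, and ( ∫_ℝ |y·f^{(m)}(y)|² dy )^{1/2} ≤ C_m · ⟨x⟩^{−(3+2m)/4} · ⟨x₀⟩, where f^{(m)} denotes the m-th derivative with respect to y. -/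
open MeasureTheory Real

/-- The difference of heat kernels `K_c(x−x₀,·) − K_c(x,·)` with
`K_c(x,y) = e^{−y²/(4x)}/√(4πx)`. -/
noncomputable def heatDiff (x₀ x w : ℝ) : ℝ :=
  Real.exp (-w ^ 2 / (4 * (x - x₀))) / Real.sqrt (4 * π * (x - x₀)) -
    Real.exp (-w ^ 2 / (4 * x)) / Real.sqrt (4 * π * x)

lemma mono_bd (n : ℕ) : ∃ B : ℝ, 0 < B ∧ ∀ z : ℝ, |z ^ n| * rexp (-(z ^ 2 / 4)) ≤ B := by
  refine ⟨1 + 4 ^ n * (n.factorial : ℝ), by positivity, fun z => ?_⟩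
  have h1 : |z ^ n| ≤ 1 + (z ^ 2) ^ n := by
    have : (z ^ 2) ^ n = |z ^ n| ^ 2 := by rw [sq_abs]; ring
    rw [this]; nlinarith [sq_nonneg (|z ^ n| - 1), abs_nonneg (z ^ n)]
  have h2 := Real.pow_div_factorial_le_exp (x := z ^ 2 / 4) (by positivity) n
  have hf : (0 : ℝ) < n.factorial := by positivity
  rw [div_le_iff₀ hf, div_pow, div_le_iff₀ (by positivity)] at h2
  have h3 : 1 ≤ rexp (z ^ 2 / 4) := Real.one_le_exp (by positivity)
  rw [Real.exp_neg, ← div_eq_mul_inv, div_le_iff₀ (Real.exp_pos _)]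
  nlinarith

lemma poly_bd (p : Polynomial ℝ) :
    ∃ B : ℝ, 0 < B ∧ ∀ z : ℝ, |p.eval z| * rexp (-(z ^ 2 / 4)) ≤ B := by
  induction p using Polynomial.induction_on' with
  | add p q hp hq =>
    obtain ⟨B, hB, h⟩ := hp
    obtain ⟨B', hB', h'⟩ := hq
    refine ⟨B + B', by positivity, fun z => ?_⟩
    rw [Polynomial.eval_add]
    have := abs_add_le (p.eval z) (q.eval z)
    have := mul_le_mul_of_nonneg_right this (Real.exp_pos (-(z ^ 2 / 4))).le
    linarith [h z, h' z]
  | monomial n c =>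
    obtain ⟨B, hB, h⟩ := mono_bd n
    refine ⟨(|c| + 1) * B, by positivity, fun z => ?_⟩
    rw [Polynomial.eval_monomial, abs_mul, mul_assoc]
    exact mul_le_mul (by linarith) (h z) (by positivity) (by positivity)

/-- the unnormalized Gaussian -/
noncomputable def gss (y : ℝ) : ℝ := rexp (-(y ^ 2 / 2))

lemma gss_smooth (n : WithTop ℕ∞) : ContDiff ℝ n gss := by
  unfold gss; fun_prop

lemma gss_iter (n : ℕ) (z : ℝ) : iteratedDeriv n gss z =
    (-1 : ℝ) ^ n * ((Polynomial.hermite n).map (Int.castRingHom ℝ)).eval z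
      * rexp (-(z ^ 2 / 2)) := by
  rw [iteratedDeriv_eq_iterate]
  have := Polynomial.deriv_gaussian_eq_hermite_mul_gaussian n z
  rw [Polynomial.eval_map]
  exact this

lemma gss_hasDeriv (n : ℕ) (z : ℝ) :
    HasDerivAt (iteratedDeriv n gss) (iteratedDeriv (n + 1) gss z) z := by
  rw [iteratedDeriv_succ]
  exact ((gss_smooth (n + 1 : ℕ)).differentiable_iteratedDeriv n
    (by exact_mod_cast Nat.lt_succ_self n) z).hasDerivAt

lemma gss_bd (m : ℕ) : ∃ B : ℝ, 0 < B ∧ ∀ z : ℝ,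
    |(m + 1) * iteratedDeriv m gss z + z * iteratedDeriv (m + 1) gss z|
      ≤ B * rexp (-(z ^ 2 / 4)) := by
  obtain ⟨B, hB, h⟩ := poly_bd
    (Polynomial.C ((m + 1 : ℝ) * (-1) ^ m) * (Polynomial.hermite m).map (Int.castRingHom ℝ)
      + Polynomial.C ((-1 : ℝ) ^ (m + 1)) * Polynomial.X *
        (Polynomial.hermite (m + 1)).map (Int.castRingHom ℝ))
  refine ⟨B, hB, fun z => ?_⟩
  have h := h z
  simp only [Polynomial.eval_add, Polynomial.eval_mul, Polynomial.eval_C, Polynomial.eval_X] at h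
  rw [gss_iter, gss_iter]
  generalize ((Polynomial.hermite m).map (Int.castRingHom ℝ)).eval z = u at *
  generalize ((Polynomial.hermite (m + 1)).map (Int.castRingHom ℝ)).eval z = v at *
  have e : rexp (-(z ^ 2 / 2)) = rexp (-(z ^ 2 / 4)) * rexp (-(z ^ 2 / 4)) := by
    rw [← Real.exp_add]; ring_nf
  have e2 : (m + 1 : ℝ) * ((-1) ^ m * u * rexp (-(z ^ 2 / 2))) +
      z * ((-1) ^ (m + 1) * v * rexp (-(z ^ 2 / 2))) =
      ((m + 1 : ℝ) * (-1) ^ m * u + (-1) ^ (m + 1) * z * v) * rexp (-(z ^ 2 / 4))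
        * rexp (-(z ^ 2 / 4)) := by rw [e]; ring
  rw [e2, abs_mul, abs_mul, abs_of_pos (Real.exp_pos _)]
  exact mul_le_mul_of_nonneg_right h (Real.exp_pos _).le

lemma kernel_eq (t w : ℝ) (ht : 0 < t) :
    rexp (-w ^ 2 / (4 * t)) / √(4 * π * t) =
      (√(2 * π))⁻¹ * ((√(2 * t))⁻¹ * gss ((√(2 * t))⁻¹ * w)) := by
  unfold gss
  have h1 : ((√(2 * t))⁻¹ * w) ^ 2 / 2 = w ^ 2 / (4 * t) := by
    rw [mul_pow, inv_pow, Real.sq_sqrt (by positivity)]; field_simp; ring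
  have h2 : √(4 * π * t) = √(2 * π) * √(2 * t) := by
    rw [← Real.sqrt_mul (by positivity)]; ring_nf
  rw [h1, h2, neg_div]
  field_simp

lemma heat_iter (m : ℕ) (x₀ x y : ℝ) (h0 : 1 ≤ x₀) (hx : 2 * x₀ ≤ x) :
    iteratedDeriv m (heatDiff x₀ x) y = (√(2 * π))⁻¹ *
      ((√(2 * (x - x₀)))⁻¹ ^ (m + 1) * iteratedDeriv m gss ((√(2 * (x - x₀)))⁻¹ * y) -
       (√(2 * x))⁻¹ ^ (m + 1) * iteratedDeriv m gss ((√(2 * x))⁻¹ * y)) := by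
  have e : heatDiff x₀ x = (fun w => (√(2 * π))⁻¹ *
      ((√(2 * (x - x₀)))⁻¹ * gss ((√(2 * (x - x₀)))⁻¹ * w) -
        (√(2 * x))⁻¹ * gss ((√(2 * x))⁻¹ * w))) := by
    funext w
    unfold heatDiff
    rw [kernel_eq _ _ (by linarith), kernel_eq _ _ (by linarith)]; ring
  have hs := gss_smooth m
  rw [e, iteratedDeriv_const_mul_field, iteratedDeriv_fun_sub, iteratedDeriv_const_mul_field,
    iteratedDeriv_const_mul_field, iteratedDeriv_comp_const_mul hs,
    iteratedDeriv_comp_const_mul hs]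
  · ring
  · exact (contDiff_const.mul (hs.comp (contDiff_const.mul contDiff_id))).contDiffAt
  · exact (contDiff_const.mul (hs.comp (contDiff_const.mul contDiff_id))).contDiffAt

lemma mvt_bd (m : ℕ) (B : ℝ) (hB : ∀ z : ℝ,
    |(m + 1) * iteratedDeriv m gss z + z * iteratedDeriv (m + 1) gss z|
      ≤ B * rexp (-(z ^ 2 / 4))) (hB0 : 0 < B) (a b y : ℝ) (ha : 0 < a) (hab : a ≤ b) :
    |b ^ (m + 1) * iteratedDeriv m gss (b * y) - a ^ (m + 1) * iteratedDeriv m gss (a * y)| ≤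
      (b ^ m * (B * rexp (-((a * y) ^ 2 / 4)))) * (b - a) := by
  have key := Convex.norm_image_sub_le_of_norm_hasDerivWithin_le
    (f := fun c : ℝ => c ^ (m + 1) * iteratedDeriv m gss (c * y))
    (f' := fun c : ℝ => c ^ m * ((m + 1) * iteratedDeriv m gss (c * y) +
      (c * y) * iteratedDeriv (m + 1) gss (c * y)))
    (s := Set.Icc a b) (x := a) (y := b) (C := b ^ m * (B * rexp (-((a * y) ^ 2 / 4))))
    ?_ ?_ (convex_Icc a b) ⟨le_rfl, hab⟩ ⟨hab, le_rfl⟩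
  · rw [Real.norm_eq_abs, Real.norm_eq_abs, abs_of_nonneg (sub_nonneg.2 hab)] at key
    exact key
  · intro c _
    have h1 : HasDerivAt (fun c : ℝ => c * y) y c := by
      simpa using (hasDerivAt_id c).mul_const y
    have h2 := (gss_hasDeriv m (c * y)).comp c h1
    have h3 := (hasDerivAt_pow (m + 1) c).mul h2
    refine HasDerivAt.hasDerivWithinAt (h3.congr_deriv ?_)
    simp only [Function.comp, Nat.add_sub_cancel]
    push_cast
    ring
  · intro c hc
    have hc0 : 0 < c := ha.trans_le hc.1
    rw [Real.norm_eq_abs, abs_mul, abs_of_pos (pow_pos hc0 m)]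
    refine mul_le_mul (pow_le_pow_left₀ hc0.le hc.2 m) ((hB _).trans ?_) (abs_nonneg _)
      (by have := hc0.trans_le hc.2; positivity)
    refine mul_le_mul_of_nonneg_left (Real.exp_le_exp.2 ?_) hB0.le
    have : (a * y) ^ 2 ≤ (c * y) ^ 2 := by
      rw [mul_pow, mul_pow]
      exact mul_le_mul_of_nonneg_right (pow_le_pow_left₀ ha.le hc.1 2) (sq_nonneg y)
    linarith

lemma pointwise_bd (m : ℕ) : ∃ D : ℝ, 0 < D ∧ ∀ x₀ x y : ℝ, 1 ≤ x₀ → 2 * x₀ ≤ x →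
    |iteratedDeriv m (heatDiff x₀ x) y| ≤
      D * x₀ * (√(2 * x))⁻¹ ^ (m + 3) * rexp (-(((√(2 * x))⁻¹ * y) ^ 2 / 4)) := by
  obtain ⟨B, hB0, hB⟩ := gss_bd m
  refine ⟨(√(2 * π))⁻¹ * (2 ^ m * B * 2), by positivity, fun x₀ x y h0 hx => ?_⟩
  have hx0 : 0 < x := by linarith
  have hd : 0 < x - x₀ := by linarith
  rw [heat_iter m x₀ x y h0 hx]
  have ha2 : (√(2 * x))⁻¹ ^ 2 = (2 * x)⁻¹ := by rw [inv_pow, Real.sq_sqrt (by positivity)]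
  have hb2 : (√(2 * (x - x₀)))⁻¹ ^ 2 = (2 * (x - x₀))⁻¹ := by
    rw [inv_pow, Real.sq_sqrt (by positivity)]
  have ha : 0 < (√(2 * x))⁻¹ := by positivity
  have hb : 0 < (√(2 * (x - x₀)))⁻¹ := by positivity
  set a := (√(2 * x))⁻¹
  set b := (√(2 * (x - x₀)))⁻¹
  have hab : a ≤ b := by
    refine (pow_le_pow_iff_left₀ ha.le hb.le two_ne_zero).1 ?_
    rw [ha2, hb2]
    exact inv_anti₀ (by positivity) (by linarith)
  have hb2a : b ≤ 2 * a := by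
    refine (pow_le_pow_iff_left₀ hb.le (by positivity) two_ne_zero).1 ?_
    rw [mul_pow, ha2, hb2, inv_eq_one_div, inv_eq_one_div, mul_one_div,
      div_le_div_iff₀ (by positivity) (by positivity)]
    linarith
  have hdiff : b ^ 2 - a ^ 2 ≤ 4 * x₀ * (a ^ 2) ^ 2 := by
    rw [ha2, hb2]
    have : (2 * (x - x₀))⁻¹ - (2 * x)⁻¹ = x₀ / (2 * x * (x - x₀)) := by field_simp; ring
    rw [this]
    have : 4 * x₀ * (2 * x)⁻¹ ^ 2 = x₀ / (x * x) := by field_simp; ring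
    rw [this]
    apply div_le_div_of_nonneg_left (by linarith) (by positivity)
    nlinarith
  have hba : b - a ≤ 2 * x₀ * a ^ 3 := by
    have h1 : (b - a) * (2 * a) ≤ (2 * x₀ * a ^ 3) * (2 * a) := by nlinarith
    exact le_of_mul_le_mul_right h1 (by positivity)
  have hm := mvt_bd m B hB hB0 a b y ha hab
  rw [abs_mul, abs_of_pos (by positivity : (0:ℝ) < (√(2 * π))⁻¹)]
  have hE := Real.exp_pos (-((a * y) ^ 2 / 4))
  set E := rexp (-((a * y) ^ 2 / 4))
  have h2 : b ^ m * (B * E) * (b - a) ≤ (2 * a) ^ m * (B * E) * (2 * x₀ * a ^ 3) := by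
    refine mul_le_mul (mul_le_mul_of_nonneg_right (pow_le_pow_left₀ hb.le hb2a m)
      (by positivity)) hba (by linarith) (by positivity)
  calc _ ≤ (√(2 * π))⁻¹ * ((2 * a) ^ m * (B * E) * (2 * x₀ * a ^ 3)) :=
        mul_le_mul_of_nonneg_left (hm.trans h2) (by positivity)
    _ = _ := by rw [mul_pow]; ring

lemma rpow_bd (a J r : ℝ) (ha : 0 < a) (hJ : 0 < J) (h : a ^ 2 ≤ J⁻¹) (hr : 0 ≤ r) :
    a ^ r ≤ J ^ (-r / 2) := by
  have h1 : a ^ r = (a ^ 2) ^ (r / 2) := by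
    rw [← Real.rpow_natCast, ← Real.rpow_mul ha.le]; congr 1; push_cast; ring
  rw [h1, neg_div, Real.rpow_neg hJ.le, ← Real.inv_rpow hJ.le]
  exact Real.rpow_le_rpow (by positivity) h (by positivity)

lemma int1_s14 : Integrable (fun z : ℝ => rexp (-(z ^ 2 / 4))) := by
  have := integrable_exp_neg_mul_sq (b := 1 / 4) (by norm_num)
  refine this.congr (Filter.Eventually.of_forall fun z => ?_)
  simp only; congr 1; ring

lemma int2_s14 : Integrable (fun z : ℝ => z ^ 2 * rexp (-(z ^ 2 / 2))) := by
  have := integrable_rpow_mul_exp_neg_mul_sq (b := 1 / 2) (by norm_num) (s := 2) (by norm_num)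
  refine this.congr (Filter.Eventually.of_forall fun z => ?_)
  simp only [Real.rpow_ofNat]; congr 2; ring


/-- For every `m ∈ ℕ` there is `C_m > 0` such that for all `x₀ ≥ 1` and
`x ≥ 2x₀`, the function `f = K_c(x−x₀,·) − K_c(x,·)` satisfies
`sup_y |f^{(m)}(y)| ≤ C_m ⟨x⟩^{−(3+m)/2} ⟨x₀⟩`,
`∫ |f^{(m)}| ≤ C_m ⟨x⟩^{−(2+m)/2} ⟨x₀⟩` and
`(∫ |y f^{(m)}(y)|² dy)^{1/2} ≤ C_m ⟨x⟩^{−(3+2m)/4} ⟨x₀⟩`. -/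
theorem stmt14 (m : ℕ) :
    ∃ C : ℝ, 0 < C ∧ ∀ x₀ x : ℝ, 1 ≤ x₀ → 2 * x₀ ≤ x →
      (∀ y : ℝ, |iteratedDeriv m (heatDiff x₀ x) y| ≤
          C * jap x ^ (-(3 + (m : ℝ)) / 2) * jap x₀) ∧
      (∫ y : ℝ, |iteratedDeriv m (heatDiff x₀ x) y|) ≤
          C * jap x ^ (-(2 + (m : ℝ)) / 2) * jap x₀ ∧
      (∫ y : ℝ, |y * iteratedDeriv m (heatDiff x₀ x) y| ^ 2) ^ ((1 : ℝ) / 2) ≤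
          C * jap x ^ (-(3 + 2 * (m : ℝ)) / 4) * jap x₀ := by
  obtain ⟨D, hD, hp⟩ := pointwise_bd m
  set M1 := ∫ z : ℝ, rexp (-(z ^ 2 / 4)) with hM1
  set M2 := ∫ z : ℝ, z ^ 2 * rexp (-(z ^ 2 / 2)) with hM2
  have hM1' : 0 ≤ M1 := integral_nonneg fun z => by positivity
  have hM2' : 0 ≤ M2 := integral_nonneg fun z => by positivity
  have hS2 : 0 ≤ √M2 := Real.sqrt_nonneg _
  refine ⟨D * (1 + M1 + √M2), by positivity, fun x₀ x h0 hx => ?_⟩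
  have hx0 : 0 < x := by linarith
  have hp := fun y => hp x₀ x y h0 hx
  have hJ : 0 < jap x := by unfold jap; positivity
  have hJ0 : x₀ ≤ jap x₀ := by
    unfold jap; apply Real.le_sqrt_of_sq_le; linarith
  have ha : 0 < (√(2 * x))⁻¹ := by positivity
  have ha2 : (√(2 * x))⁻¹ ^ 2 ≤ (jap x)⁻¹ := by
    rw [inv_pow, Real.sq_sqrt (by positivity)]
    apply inv_anti₀ hJ
    unfold jap
    apply Real.sqrt_le_iff.2 ⟨by positivity, by nlinarith⟩
  set a := (√(2 * x))⁻¹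
  have hx0' : 0 < x₀ := by linarith
  have fin : ∀ K r : ℝ, 0 ≤ K → K ≤ 1 + M1 + √M2 → 0 ≤ r →
      D * x₀ * a ^ r * K ≤ D * (1 + M1 + √M2) * jap x ^ (-r / 2) * jap x₀ := by
    intro K r hK0 hK hr
    have h1 := rpow_bd a (jap x) r ha hJ ha2 hr
    have hJ0' : 0 < jap x₀ := hx0'.trans_le hJ0
    have h2 : 0 < a ^ r := Real.rpow_pos_of_pos ha r
    calc D * x₀ * a ^ r * K ≤ D * jap x₀ * jap x ^ (-r / 2) * (1 + M1 + √M2) := by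
          gcongr
      _ = _ := by ring
  refine ⟨fun y => ?_, ?_, ?_⟩
  · have h := fin 1 (3 + m) zero_le_one (by linarith) (by positivity)
    refine le_trans ((hp y).trans ?_) h
    have e : a ^ (3 + (m : ℝ)) = a ^ (m + 3) := by
      rw [← Real.rpow_natCast]; congr 1; push_cast; ring
    rw [e]
    apply mul_le_mul_of_nonneg_left _ (by positivity)
    exact Real.exp_le_one_iff.2 (by have := sq_nonneg (a * y); linarith)
  · have h := fin M1 (2 + m) hM1' (by linarith) (by positivity)
    refine le_trans ?_ h
    have i1 : Integrable (fun y : ℝ => rexp (-((a * y) ^ 2 / 4))) :=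
      int1_s14.comp_mul_left' ha.ne'
    calc _ ≤ ∫ y : ℝ, D * x₀ * a ^ (m + 3) * rexp (-((a * y) ^ 2 / 4)) :=
          integral_mono_of_nonneg (Filter.Eventually.of_forall fun y => abs_nonneg _)
            (i1.const_mul _) (Filter.Eventually.of_forall hp)
      _ = D * x₀ * a ^ (m + 3) * (a⁻¹ * M1) := by
          rw [integral_const_mul,
            Measure.integral_comp_mul_left (fun z : ℝ => rexp (-(z ^ 2 / 4))) a,
            abs_of_pos (by positivity), smul_eq_mul]
      _ = _ := by
          have e : a ^ (2 + (m : ℝ)) = a ^ (m + 2) := by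
            rw [← Real.rpow_natCast]; congr 1; push_cast; ring
          rw [e]; field_simp; ring
  · have h := fin (√M2) ((3 + 2 * m) / 2) hS2 (by linarith) (by positivity)
    have e0 : -((3 + 2 * (m : ℝ)) / 2) / 2 = -(3 + 2 * (m : ℝ)) / 4 := by ring
    rw [e0] at h
    refine le_trans ?_ h
    have i2 : Integrable (fun y : ℝ => (a * y) ^ 2 * rexp (-((a * y) ^ 2 / 2))) :=
      int2_s14.comp_mul_left' ha.ne'
    have hI : (∫ y : ℝ, |y * iteratedDeriv m (heatDiff x₀ x) y| ^ 2) ≤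
        (D * x₀) ^ 2 * a ^ (2 * m + 3) * M2 := by
      calc _ ≤ ∫ y : ℝ, (D * x₀) ^ 2 * a ^ (2 * m + 4) *
              ((a * y) ^ 2 * rexp (-((a * y) ^ 2 / 2))) := by
            refine integral_mono_of_nonneg (Filter.Eventually.of_forall fun y => by positivity)
              (i2.const_mul _) (Filter.Eventually.of_forall fun y => ?_)
            simp only
            have e : rexp (-((a * y) ^ 2 / 2)) = rexp (-((a * y) ^ 2 / 4)) ^ 2 := by
              rw [← Real.exp_nat_mul]; congr 1; push_cast; ring
            rw [e, abs_mul, mul_pow, sq_abs]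
            calc _ ≤ y ^ 2 * (D * x₀ * a ^ (m + 3) * rexp (-((a * y) ^ 2 / 4))) ^ 2 :=
                  mul_le_mul_of_nonneg_left (pow_le_pow_left₀ (abs_nonneg _) (hp y) 2)
                    (sq_nonneg y)
              _ = _ := by ring
        _ = (D * x₀) ^ 2 * a ^ (2 * m + 4) * (a⁻¹ * M2) := by
            rw [integral_const_mul, Measure.integral_comp_mul_left
              (fun z : ℝ => z ^ 2 * rexp (-(z ^ 2 / 2))) a,
              abs_of_pos (by positivity), smul_eq_mul]
        _ = _ := by field_simp; ring
    rw [← Real.sqrt_eq_rpow]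
    refine (Real.sqrt_le_sqrt hI).trans (le_of_eq ?_)
    have e : a ^ (2 * m + 3) = (a ^ ((3 + 2 * (m : ℝ)) / 2)) ^ 2 := by
      rw [← Real.rpow_natCast, ← Real.rpow_natCast, ← Real.rpow_mul ha.le]
      congr 1; push_cast; ring
    have hr : 0 < a ^ ((3 + 2 * (m : ℝ)) / 2) := Real.rpow_pos_of_pos ha _
    rw [e, ← mul_pow, Real.sqrt_mul (by positivity), Real.sqrt_sq (by positivity)]
end

section
/- The function h : ℝ → ℝ defined by h(z) = e^{−z²/2}/(4π) + (1/(8√π)) · z · erf(z/2) · e^{−z²/4} is twice differentiable and satisfies, for all y ∈ ℝ, the ordinary differential equation h″(y) + (y/2)·h′(y) + h(y) = e^{−y²/2}/(4π), together with the initial conditions h(0) = 1/(4π) and h′(0) = 0. -/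
open Real

/-- The error function `erf(u) = (2/√π) ∫₀^u e^{−t²} dt`. -/
noncomputable def erfFn (u : ℝ) : ℝ := (2 / Real.sqrt π) * ∫ t in (0 : ℝ)..u, Real.exp (-t ^ 2)

/-- `h(z) = e^{−z²/2}/(4π) + (1/(8√π)) z erf(z/2) e^{−z²/4}`. -/
noncomputable def hFn (z : ℝ) : ℝ :=
  Real.exp (-z ^ 2 / 2) / (4 * π) +
    (1 / (8 * Real.sqrt π)) * z * erfFn (z / 2) * Real.exp (-z ^ 2 / 4)

theorem erf_half_deriv (z : ℝ) :
    HasDerivAt (fun z => erfFn (z / 2)) (1 / Real.sqrt π * Real.exp (-z ^ 2 / 4)) z := by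
  have hc : Continuous (fun t : ℝ => Real.exp (-t ^ 2)) := by fun_prop
  have h1 : HasDerivAt (fun u : ℝ => ∫ t in (0 : ℝ)..u, Real.exp (-t ^ 2))
      (Real.exp (-(z / 2) ^ 2)) (z / 2) := hc.integral_hasStrictDerivAt 0 (z / 2) |>.hasDerivAt
  have h2 : HasDerivAt (fun z : ℝ => z / 2) (1 / 2) z := (hasDerivAt_id z).div_const 2
  have h3 := (h1.comp z h2).const_mul (2 / Real.sqrt π)
  refine h3.congr_deriv ?_
  rw [show -(z / 2) ^ 2 = -z ^ 2 / 4 by ring]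
  ring

theorem gauss_deriv (a z : ℝ) :
    HasDerivAt (fun z : ℝ => Real.exp (-z ^ 2 / a)) (-(2 * z / a) * Real.exp (-z ^ 2 / a)) z := by
  have h := (((hasDerivAt_pow 2 z).neg).div_const a).exp
  refine h.congr_deriv ?_
  simp
  ring

theorem gauss_sq (z : ℝ) : Real.exp (-z ^ 2 / 2) = Real.exp (-z ^ 2 / 4) ^ 2 := by
  rw [← Real.exp_nat_mul]
  congr 1
  push_cast
  ring

theorem inv_pi_eq : π⁻¹ = (Real.sqrt π)⁻¹ ^ 2 := by
  rw [inv_pow, Real.sq_sqrt Real.pi_pos.le]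

/-- The first derivative of `hFn`. -/
noncomputable def hFnD (z : ℝ) : ℝ :=
  -z * Real.exp (-z ^ 2 / 2) / (8 * π) +
    (1 / (8 * Real.sqrt π)) * (1 - z ^ 2 / 2) * erfFn (z / 2) * Real.exp (-z ^ 2 / 4)

/-- The second derivative of `hFn`. -/
noncomputable def hFnDD (z : ℝ) : ℝ :=
  Real.exp (-z ^ 2 / 2) / (4 * π) - (z / 2) * hFnD z - hFn z

theorem hFn_deriv (z : ℝ) : HasDerivAt hFn (hFnD z) z := by
  have h := ((gauss_deriv 2 z).div_const (4 * π)).add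
    ((((hasDerivAt_id z).const_mul (1 / (8 * Real.sqrt π))).mul (erf_half_deriv z)).mul
      (gauss_deriv 4 z))
  refine h.congr_deriv ?_
  simp only [hFnD, gauss_sq]
  simp only [id, div_eq_mul_inv, mul_inv, inv_pi_eq, Pi.mul_apply]
  ring

theorem hFnD_deriv (z : ℝ) : HasDerivAt hFnD (hFnDD z) z := by
  have h := (((hasDerivAt_id z).neg.mul (gauss_deriv 2 z)).div_const (8 * π)).add
    ((((((hasDerivAt_pow 2 z).div_const 2).const_sub 1).const_mul
      (1 / (8 * Real.sqrt π))).mul (erf_half_deriv z)).mul (gauss_deriv 4 z))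
  refine h.congr_deriv ?_
  simp only [hFnDD, hFnD, hFn, gauss_sq]
  simp only [id, div_eq_mul_inv, mul_inv, inv_pi_eq, Pi.mul_apply,
    Pi.neg_apply]
  push_cast
  ring

/-- The function `h` is twice differentiable and satisfies the ODE
`h″(y) + (y/2) h′(y) + h(y) = e^{−y²/2}/(4π)` for all `y`, with `h(0) = 1/(4π)` and
`h′(0) = 0`. -/
theorem stmt16 :
    Differentiable ℝ hFn ∧ Differentiable ℝ (deriv hFn) ∧
    (∀ y : ℝ, deriv (deriv hFn) y + (y / 2) * deriv hFn y + hFn y =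
        Real.exp (-y ^ 2 / 2) / (4 * π)) ∧
    hFn 0 = 1 / (4 * π) ∧ deriv hFn 0 = 0 := by
  have e1 : deriv hFn = hFnD := funext fun z => (hFn_deriv z).deriv
  have e2 : deriv hFnD = hFnDD := funext fun z => (hFnD_deriv z).deriv
  rw [e1, e2]
  refine ⟨fun z => (hFn_deriv z).differentiableAt, fun z => (hFnD_deriv z).differentiableAt,
    fun y => ?_, ?_, ?_⟩
  · simp only [hFnDD]
    ring
  · simp [hFn]
  · simp [hFnD, erfFn]
end
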